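/- arXiv:1203.1911 — 2 statements merged into one kernel-verified Lean document; each statement's English description precedes it below -/
import Mathlib

section
/- For each prime power q, all integers m > c ≥ 0, and any real number ε > 0, there is an integer R (depending on m, q, c, ε) such that for all n > R the following holds: if G is any set of points of PG(n-1,q) with |G| ≤ (1-ε)·(q^{n-c+1}-1)/(q-1), then there exists a rank-m flat F of PG(n-1,q) such that the rank of F ∩ G is at most m - c. -/
/-- Containment of geometries: `H`, a set of points of `PG(m-1,q)`, is contained in a set
`M` of points of `PG(n-1,q)` if some injective linear map `F^m → F^n` maps `H` into `M`. -/
def PGContains (F : Type) [Field F] (m n : ℕ)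
    (H : Set (Projectivization F (Fin m → F)))
    (M : Set (Projectivization F (Fin n → F))) : Prop :=
  ∃ (f : (Fin m → F) →ₗ[F] (Fin n → F)) (hf : Function.Injective f),
    ∀ x ∈ H, Projectivization.map f hf x ∈ M

/-- The rank of a set of points: the dimension of its linear span. -/
noncomputable def pgRank (F : Type) [Field F] (n : ℕ)
    (G : Set (Projectivization F (Fin n → F))) : ℕ :=
  Module.finrank F ↥(⨆ x ∈ G, x.submodule)

/-- The flat determined by a subspace `W`: all projective points lying in `W`. -/
def pgFlat (F : Type) [Field F] (n : ℕ) (W : Submodule F (Fin n → F)) :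
    Set (Projectivization F (Fin n → F)) :=
  {x | x.submodule ≤ W}

/-- The standard rank-`k` subspace of `F^m`: vectors vanishing on coordinates `≥ k`. -/
def stdSubspace (F : Type) [Field F] (m k : ℕ) : Submodule F (Fin m → F) :=
  LinearMap.ker (LinearMap.funLeft F F (fun i : {i : Fin m // k ≤ (i : ℕ)} => (i : Fin m)))

/-- `G(m-1,q,c)`: the points of `PG(m-1,q)` outside a rank-`(m-c)` flat. -/
def pgDel (F : Type) [Field F] (m c : ℕ) : Set (Projectivization F (Fin m → F)) :=
  {x | ¬ x.submodule ≤ stdSubspace F m (m - c)}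

/-- `ex_q(H; n)`: the maximum size of a set of points of `PG(n-1,q)` not containing `H`. -/
noncomputable def pgEx (F : Type) [Field F] (m : ℕ)
    (H : Set (Projectivization F (Fin m → F))) (n : ℕ) : ℕ :=
  sSup {k | ∃ M : Set (Projectivization F (Fin n → F)),
    ¬ PGContains F m n H M ∧ M.ncard = k}

/-- The critical exponent of a geometry `H`: the least `c` such that `H` is contained in
`G(r-1,q,c)`, where `r` is the rank of `H`. -/
noncomputable def critExp (F : Type) [Field F] (m : ℕ)
    (H : Set (Projectivization F (Fin m → F))) : ℕ :=
  sInf {c | PGContains F m (pgRank F m H) H (pgDel F (pgRank F m H) c)}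

namespace DensityHalesJewett

section Average

variable {X Y : Type*}

/-- The average of a real function on a finite type (zero on the empty type). -/
noncomputable def av [Finite X] (f : X → ℝ) : ℝ :=
  letI := Fintype.ofFinite X
  (∑ x, f x) / Nat.card X

/-- The real-valued indicator function of a set. -/
noncomputable def ind (A : Set X) : X → ℝ := A.indicator 1

lemma ind_of_mem {A : Set X} {x : X} (h : x ∈ A) : ind A x = 1 := by simp [ind, h]

lemma ind_of_notMem {A : Set X} {x : X} (h : x ∉ A) : ind A x = 0 := by simp [ind, h]

lemma ind_nonneg (A : Set X) (x : X) : 0 ≤ ind A x := by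
  by_cases h : x ∈ A <;> simp [ind, h]

lemma ind_le_one (A : Set X) (x : X) : ind A x ≤ 1 := by
  by_cases h : x ∈ A <;> simp [ind, h]

lemma ind_congr {A : Set X} {B : Set Y} {x : X} {y : Y} (h : x ∈ A ↔ y ∈ B) :
    ind A x = ind B y := by
  by_cases hx : x ∈ A
  · rw [ind_of_mem hx, ind_of_mem (h.1 hx)]
  · rw [ind_of_notMem hx, ind_of_notMem (fun hy => hx (h.2 hy))]

variable [Finite X] [Finite Y]

lemma av_eq [Fintype X] (f : X → ℝ) : av f = (∑ x, f x) / Fintype.card X := by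
  rw [av, Nat.card_eq_fintype_card]
  congr!

lemma av_mono {f g : X → ℝ} (h : ∀ x, f x ≤ g x) : av f ≤ av g := by
  have := Fintype.ofFinite X
  rw [av_eq, av_eq]
  gcongr
  exact h _

lemma av_nonneg {f : X → ℝ} (h : ∀ x, 0 ≤ f x) : 0 ≤ av f := by
  have := Fintype.ofFinite X
  rw [av_eq]
  exact div_nonneg (Finset.sum_nonneg fun _ _ => h _) (by positivity)

lemma av_add (f g : X → ℝ) : av (fun x => f x + g x) = av f + av g := by
  have := Fintype.ofFinite X
  rw [av_eq, av_eq, av_eq, Finset.sum_add_distrib, add_div]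

lemma av_sub (f g : X → ℝ) : av (fun x => f x - g x) = av f - av g := by
  have := Fintype.ofFinite X
  rw [av_eq, av_eq, av_eq, Finset.sum_sub_distrib, sub_div]

lemma av_const_mul (c : ℝ) (f : X → ℝ) : av (fun x => c * f x) = c * av f := by
  have := Fintype.ofFinite X
  rw [av_eq, av_eq, ← Finset.mul_sum, mul_div_assoc]

lemma av_const [Nonempty X] (c : ℝ) : av (fun _ : X => c) = c := by
  have := Fintype.ofFinite X
  rw [av_eq]
  simp

lemma av_const_le {c : ℝ} (hc : 0 ≤ c) : av (fun _ : X => c) ≤ c := by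
  rcases isEmpty_or_nonempty X with h | h
  · simpa [av] using hc
  · exact (av_const c).le

lemma av_le_of_le {f : X → ℝ} {c : ℝ} (hc : 0 ≤ c) (h : ∀ x, f x ≤ c) : av f ≤ c :=
  (av_mono h).trans (av_const_le hc)

lemma av_ind_le_one (A : Set X) : av (ind A) ≤ 1 :=
  av_le_of_le zero_le_one (ind_le_one A)

lemma av_sum {T : Type*} [Fintype T] (f : T → X → ℝ) :
    av (fun x => ∑ t, f t x) = ∑ t, av (f t) := by
  have := Fintype.ofFinite X
  simp_rw [av_eq]
  rw [Finset.sum_comm, Finset.sum_div]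

lemma av_equiv (e : X ≃ Y) (f : Y → ℝ) : av (fun x => f (e x)) = av f := by
  have := Fintype.ofFinite X
  have := Fintype.ofFinite Y
  rw [av_eq, av_eq, Fintype.card_congr e, Equiv.sum_comp e f]

lemma av_prod (f : X × Y → ℝ) : av f = av (fun x => av (fun y => f (x, y))) := by
  have := Fintype.ofFinite X
  have := Fintype.ofFinite Y
  simp_rw [av_eq]
  rw [Fintype.sum_prod_type, Fintype.card_prod, ← Finset.sum_div, div_div]
  push_cast
  rw [mul_comm]

lemma av_comm (f : X → Y → ℝ) :
    av (fun x => av (fun y => f x y)) = av (fun y => av (fun x => f x y)) := by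
  rw [← av_prod (fun p : X × Y => f p.1 p.2), ← av_prod (fun p : Y × X => f p.2 p.1)]
  exact av_equiv (Equiv.prodComm X Y) (fun p : Y × X => f p.2 p.1)

lemma av_sumElim {ι κ α : Type*} [Finite ι] [Finite κ] [Finite α] (f : (ι ⊕ κ → α) → ℝ) :
    av f = av (fun y : ι → α => av (fun z : κ → α => f (Sum.elim y z))) := by
  rw [← av_prod (fun p : (ι → α) × (κ → α) => f (Sum.elim p.1 p.2)),
    ← av_equiv (Equiv.sumArrowEquivProdArrow ι κ α)]
  simp [Equiv.sumArrowEquivProdArrow]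

lemma exists_av_le [Nonempty X] (f : X → ℝ) : ∃ x, av f ≤ f x := by
  have := Fintype.ofFinite X
  by_contra! h
  have h1 : ∑ x, f x < ∑ _x : X, av f :=
    Finset.sum_lt_sum_of_nonempty Finset.univ_nonempty fun x _ => h x
  rw [av_eq] at h1
  simp only [Finset.sum_const, Finset.card_univ, nsmul_eq_mul] at h1
  rw [mul_div_cancel₀ _ (by positivity)] at h1
  exact lt_irrefl _ h1

lemma exists_pos_of_av_pos {f : X → ℝ} (h : 0 < av f) : ∃ x, 0 < f x := by
  by_contra! h'
  have : av f ≤ 0 := av_le_of_le le_rfl h'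
  linarith

lemma av_ind_range {f : Y → X} (hf : Function.Injective f) (g : X → ℝ) :
    av (fun x => ind (Set.range f) x * g x) =
      (Nat.card Y / Nat.card X : ℝ) * av (fun y => g (f y)) := by
  classical
  have := Fintype.ofFinite X
  have := Fintype.ofFinite Y
  have h : ∑ x, ind (Set.range f) x * g x = ∑ y, g (f y) := by
    rw [← Finset.sum_image (s := Finset.univ) (g := f) (f := g) (fun a _ b _ h => hf h)]
    rw [← Finset.sum_subset (Finset.subset_univ (Finset.univ.image f))]
    · refine Finset.sum_congr rfl fun x hx => ?_
      rw [ind_of_mem (by simpa using hx), one_mul]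
    · intro x _ hx
      rw [ind_of_notMem (by simpa using hx), zero_mul]
  rw [av_eq, av_eq, h, Nat.card_eq_fintype_card, Nat.card_eq_fintype_card]
  rcases isEmpty_or_nonempty Y with hY | hY
  · simp
  · field_simp

/-- If a function bounded by `1` has average at least `β`, and at every point where it is at least
`β / 2` one of finitely many events occurs, then some event has large density. -/
lemma exists_event_of_av_ge {T : Type*} [Finite T] {f : X → ℝ} {β : ℝ} (hβ : 0 < β)
    (hf : ∀ x, f x ≤ 1) (hav : β ≤ av f) (P : T → X → Prop)
    (hP : ∀ x, β / 2 ≤ f x → ∃ t, P t x) :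
    0 < Nat.card T ∧ ∃ t, β / (2 * Nat.card T) ≤ av (ind {x | P t x}) := by
  have := Fintype.ofFinite T
  have h1 : ∀ x, f x - β / 2 ≤ ∑ t, ind {x | P t x} x := by
    intro x
    by_cases h : β / 2 ≤ f x
    · obtain ⟨t, ht⟩ := hP x h
      have : ind {x | P t x} x ≤ ∑ t, ind {x | P t x} x :=
        Finset.single_le_sum (f := fun t => ind {x | P t x} x)
          (fun t _ => ind_nonneg _ _) (Finset.mem_univ t)
      rw [ind_of_mem (show x ∈ {x | P t x} from ht)] at this
      linarith [hf x]
    · have : 0 ≤ ∑ t, ind {x | P t x} x := Finset.sum_nonneg fun t _ => ind_nonneg _ _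
      linarith
  have h2 : β / 2 ≤ ∑ t, av (ind {x | P t x}) := by
    have h3 := av_mono h1
    rw [av_sub, av_sum] at h3
    have h4 : av (fun _ : X => β / 2) ≤ β / 2 := av_const_le (by linarith)
    linarith
  rcases isEmpty_or_nonempty T with hT | hT
  · simp only [Finset.univ_eq_empty, Finset.sum_empty] at h2
    linarith
  · refine ⟨Nat.card_pos, ?_⟩
    by_contra! h
    have h3 : ∑ t, av (ind {x | P t x}) < ∑ _t : T, β / (2 * Nat.card T) :=
      Finset.sum_lt_sum_of_nonempty Finset.univ_nonempty fun x _ => h x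
    rw [Finset.sum_const, Finset.card_univ, nsmul_eq_mul, Nat.card_eq_fintype_card] at h3
    have : (0 : ℝ) < Fintype.card T := by exact_mod_cast Fintype.card_pos
    have h5 : (Fintype.card T : ℝ) * (β / (2 * Fintype.card T)) = β / 2 := by field_simp
    linarith

end Average

section Subspaces

variable {α η θ ι κ : Type}

instance [Finite α] [Finite η] [Finite ι] : Finite (Combinatorics.Subspace η α ι) :=
  Finite.of_injective (fun V => V.idxFun) fun _ _ h => Combinatorics.Subspace.ext h

/-- The composition of two combinatorial subspaces. -/
def comp (V : Combinatorics.Subspace η α ι) (W : Combinatorics.Subspace θ α η) :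
    Combinatorics.Subspace θ α ι where
  idxFun i := (V.idxFun i).elim Sum.inl W.idxFun
  proper e := by
    obtain ⟨j, hj⟩ := W.proper e
    obtain ⟨i, hi⟩ := V.proper j
    exact ⟨i, by simp [hi, hj]⟩

lemma comp_apply (V : Combinatorics.Subspace η α ι) (W : Combinatorics.Subspace θ α η)
    (x : θ → α) : comp V W x = V (W x) := by
  ext i
  rw [Combinatorics.Subspace.apply_def, Combinatorics.Subspace.apply_def]
  cases h : V.idxFun i <;> simp [comp, h, Combinatorics.Subspace.apply_def]

/-- A combinatorial subspace on the first coordinates and a point on the others. -/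
def horizontal (V : Combinatorics.Subspace η α ι) (z : κ → α) :
    Combinatorics.Subspace η α (ι ⊕ κ) where
  idxFun := Sum.elim V.idxFun (fun i => Sum.inl (z i))
  proper e := by
    obtain ⟨i, hi⟩ := V.proper e
    exact ⟨Sum.inl i, hi⟩

lemma horizontal_apply (V : Combinatorics.Subspace η α ι) (z : κ → α) (x : η → α) :
    horizontal V z x = Sum.elim (V x) z := by
  ext i
  cases i <;> simp [horizontal, Combinatorics.Subspace.apply_def]

/-- A point on the first coordinates and a combinatorial subspace on the others. -/
def vertical (y : ι → α) (V : Combinatorics.Subspace η α κ) :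
    Combinatorics.Subspace η α (ι ⊕ κ) where
  idxFun := Sum.elim (fun i => Sum.inl (y i)) V.idxFun
  proper e := by
    obtain ⟨i, hi⟩ := V.proper e
    exact ⟨Sum.inr i, hi⟩

lemma vertical_apply (y : ι → α) (V : Combinatorics.Subspace η α κ) (x : η → α) :
    vertical y V x = Sum.elim y (V x) := by
  ext i
  cases i <;> simp [vertical, Combinatorics.Subspace.apply_def]

lemma subspace_injective (V : Combinatorics.Subspace η α ι) :
    Function.Injective (V : (η → α) → ι → α) := by
  intro x y h
  ext e
  obtain ⟨i, hi⟩ := V.proper e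
  have := congrFun h i
  rwa [Combinatorics.Subspace.apply_inr hi, Combinatorics.Subspace.apply_inr hi] at this

/-- The subspace of dimension `Option η` spanned by a line and an `η`-dimensional subspace. -/
def lineProd (L : Combinatorics.Subspace Unit α ι) (V : Combinatorics.Subspace η α κ) :
    Combinatorics.Subspace (Option η) α (ι ⊕ κ) where
  idxFun := Sum.elim (fun i => (L.idxFun i).map id (fun _ => none))
    (fun i => (V.idxFun i).map id some)
  proper e := by
    rcases e with _ | e
    · obtain ⟨i, hi⟩ := L.proper ()
      exact ⟨Sum.inl i, by simp [hi]⟩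
    · obtain ⟨i, hi⟩ := V.proper e
      exact ⟨Sum.inr i, by simp [hi]⟩

lemma lineProd_apply (L : Combinatorics.Subspace Unit α ι) (V : Combinatorics.Subspace η α κ)
    (x : Option η → α) :
    lineProd L V x = Sum.elim (L fun _ => x none) (V fun e => x (some e)) := by
  ext i
  rcases i with i | i
  · cases h : L.idxFun i <;> simp [lineProd, h, Combinatorics.Subspace.apply_def]
  · cases h : V.idxFun i <;> simp [lineProd, h, Combinatorics.Subspace.apply_def]

/-- `Forces η α δ ι`: every subset of `ι → α` of density at least `δ` contains a combinatorial
subspace of dimension `η`. -/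
def Forces (η α : Type) (δ : ℝ) (ι : Type) [Finite α] [Finite ι] : Prop :=
  ∀ A : Set (ι → α), δ ≤ av (ind A) → ∃ V : Combinatorics.Subspace η α ι, ∀ x, V x ∈ A

variable [Finite α]

/-- `DHJ η α` is the density Hales-Jewett theorem for `η`-dimensional subspaces and the
alphabet `α`. -/
def DHJ (η α : Type) [Finite α] : Prop :=
  ∀ δ : ℝ, 0 < δ → ∃ (ι : Type) (_ : Finite ι), Forces η α δ ι

lemma Forces.exists_of_injective [Nonempty α] [Finite ι] [Finite κ] {δ : ℝ}
    (h : Forces η α δ ι) {g : ι → κ} (hg : Function.Injective g) (A : Set (κ → α))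
    (hA : δ ≤ av (ind A)) :
    ∃ V : Combinatorics.Subspace η α κ, (∀ x, V x ∈ A) ∧
      ∀ e, ∃ i, V.idxFun (g i) = Sum.inr e := by
  classical
  let E : ι ⊕ {k // k ∉ Set.range g} ≃ κ :=
    ((Equiv.ofInjective g hg).sumCongr (Equiv.refl _)).trans (Equiv.Set.sumCompl (Set.range g))
  have hE : ∀ i, E (Sum.inl i) = g i := fun i => rfl
  rw [← av_equiv (E.arrowCongr (Equiv.refl α)), av_sumElim, av_comm] at hA
  obtain ⟨z, hz⟩ := exists_av_le (fun z : {k // k ∉ Set.range g} → α => av (fun y : ι → α =>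
    ind A ((E.arrowCongr (Equiv.refl α)) (Sum.elim y z))))
  obtain ⟨V, hV⟩ := h {y | E.arrowCongr (Equiv.refl α) (Sum.elim y z) ∈ A}
    (hA.trans (hz.trans (av_mono fun y => (ind_congr Iff.rfl).le)))
  refine ⟨(horizontal V z).reindex (Equiv.refl _) (Equiv.refl _) E, fun x => ?_, fun e => ?_⟩
  · have h1 : (horizontal V z).reindex (Equiv.refl _) (Equiv.refl _) E x =
        E.arrowCongr (Equiv.refl α) (Sum.elim (V x) z) := by
      ext k
      simp [Combinatorics.Subspace.reindex_apply, horizontal_apply, Equiv.arrowCongr]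
    rw [h1]
    exact hV x
  · obtain ⟨i, hi⟩ := V.proper e
    refine ⟨i, ?_⟩
    simp [Combinatorics.Subspace.reindex, ← hE, horizontal, hi]

lemma DHJ.congr {η θ : Type} (h : DHJ η α) (e : η ≃ θ) : DHJ θ α := by
  intro δ hδ
  obtain ⟨ι, _, hι⟩ := h δ hδ
  refine ⟨ι, inferInstance, fun A hA => ?_⟩
  obtain ⟨V, hV⟩ := hι A hA
  refine ⟨V.reindex e (Equiv.refl _) (Equiv.refl _), fun x => ?_⟩
  have h1 : V.reindex e (Equiv.refl _) (Equiv.refl _) x = V (x ∘ e) := by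
    ext k
    simp [Combinatorics.Subspace.reindex_apply]
  rw [h1]
  exact hV _

lemma DHJ.of_isEmpty (η : Type) [IsEmpty η] : DHJ η α := by
  refine fun δ hδ => ⟨Unit, inferInstance, fun A hA => ?_⟩
  obtain ⟨x, hx⟩ := exists_pos_of_av_pos (hδ.trans_le hA)
  have hxA : x ∈ A := by
    by_contra h
    rw [ind_of_notMem h] at hx
    exact lt_irrefl _ hx
  exact ⟨⟨fun i => Sum.inl (x i), isEmptyElim⟩, fun y => hxA⟩

lemma DHJ.option (h : DHJ Unit α) (hη : DHJ η α) : DHJ (Option η) α := by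
  intro δ hδ
  obtain ⟨ι, _, hι⟩ := h (δ / 2) (by linarith)
  by_cases hT : 0 < Nat.card (Combinatorics.Subspace Unit α ι)
  · obtain ⟨κ, _, hκ⟩ := hη (δ / (2 * Nat.card (Combinatorics.Subspace Unit α ι)))
      (by positivity)
    refine ⟨ι ⊕ κ, inferInstance, fun A hA => ?_⟩
    rw [av_sumElim, av_comm] at hA
    obtain ⟨-, L, hL⟩ := exists_event_of_av_ge hδ
      (fun z => av_le_of_le zero_le_one fun y => ind_le_one _ _) hA
      (fun (L : Combinatorics.Subspace Unit α ι) z => ∀ x, Sum.elim (L x) z ∈ A)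
      (fun z hz => hι {y | Sum.elim y z ∈ A}
        (hz.trans (av_mono fun y => (ind_congr Iff.rfl).le)))
    obtain ⟨V, hV⟩ := hκ _ hL
    refine ⟨lineProd L V, fun x => ?_⟩
    rw [lineProd_apply]
    exact hV _ _
  · refine ⟨ι, inferInstance, fun A hA => ?_⟩
    obtain ⟨L, -⟩ := hι A (by linarith)
    have : Nonempty (Combinatorics.Subspace Unit α ι) := ⟨L⟩
    exact absurd Nat.card_pos hT

/-- The density Hales-Jewett theorem for lines implies the multidimensional version. -/
lemma DHJ.multidim (h : DHJ Unit α) (η : Type) [Finite η] : DHJ η α := by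
  induction η using Finite.induction_empty_option with
  | of_equiv e ih => exact ih.congr e
  | h_empty => exact DHJ.of_isEmpty _
  | h_option ih => exact h.option ih

end Subspaces

section Insensitive

variable {α η θ ι κ : Type}

/-- A set of words over `Option α` is `a`-insensitive if membership does not change when letters
`none` are replaced by `some a` or conversely. -/
def Insens (a : α) (D : Set (ι → Option α)) : Prop :=
  ∀ x y : ι → Option α, (∀ i, (x i).getD a = (y i).getD a) → x ∈ D → y ∈ D

lemma av_prod_pow {X : Type} [Finite X] [Fintype ι] (g : X → ℝ) :
    av (fun w : ι → X => ∏ i, g (w i)) = av g ^ Fintype.card ι := by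
  classical
  have := Fintype.ofFinite X
  rw [av_eq, av_eq, Fintype.card_fun, div_pow]
  push_cast
  congr 1
  rw [← Finset.card_univ, ← Finset.prod_const, Finset.prod_univ_sum, Fintype.piFinset_univ]

lemma av_mask [Finite α] [Nonempty α] [Finite ι] (f : (ι → Option α) → ℝ) :
    av (fun w : ι → Option α => av (fun y : ι → α => f (fun e => (w e).map (fun _ => y e)))) =
      av f := by
  have : NeZero (Nat.card α) := ⟨Nat.card_pos.ne'⟩
  let : AddGroup α := (Finite.equivFin α).addGroup
  have h1 : ∀ w : ι → Option α,
      av (fun y : ι → α => f (fun e => (w e).map (fun _ => y e))) =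
        av (fun y : ι → α => f (fun e => (w e).map (fun s => s + y e))) := by
    intro w
    rw [← av_equiv (Equiv.addLeft (fun e => (w e).getD 0))]
    congr 1
    ext y
    congr 1
    ext e
    cases h : w e <;> simp [h]
  simp_rw [h1]
  rw [av_comm]
  have h2 : ∀ y : ι → α, av (fun w : ι → Option α => f (fun e => (w e).map (fun s => s + y e))) =
      av f := fun y =>
    av_equiv (Equiv.piCongrRight fun e => Equiv.optionCongr (Equiv.addRight (y e))) f
  simp_rw [h2]
  exact av_const _

lemma av_ind_few_some [Finite α] [Fintype ι] (j : ℕ) :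
    av (ind {w : ι → Option α | (Finset.univ.filter fun e => (w e).isSome).card < j}) ≤
      2 ^ j * av (fun o : Option α => if o.isSome then (1 / 2 : ℝ) else 1) ^ Fintype.card ι := by
  rw [← av_prod_pow, ← av_const_mul]
  refine av_mono fun w => ?_
  have h1 : ∏ e, (if (w e).isSome then (1 / 2 : ℝ) else 1) =
      (1 / 2) ^ (Finset.univ.filter fun e => (w e).isSome).card := by
    rw [← Finset.prod_filter, Finset.prod_const]
  rw [h1]
  by_cases h : (Finset.univ.filter fun e => (w e).isSome).card < j
  · refine (ind_le_one _ _).trans ?_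
    calc (1 : ℝ) = 2 ^ j * (1 / 2) ^ j := by rw [← mul_pow]; norm_num
      _ ≤ _ := by
        gcongr 2 ^ j * ?_
        exact pow_le_pow_of_le_one (by norm_num) (by norm_num) h.le
  · rw [ind_of_notMem (by exact h)]
    positivity

lemma av_half_lt_one [Finite α] [Nonempty α] :
    av (fun o : Option α => if o.isSome then (1 / 2 : ℝ) else 1) < 1 := by
  have := Fintype.ofFinite α
  rw [av_eq, Fintype.sum_option, Fintype.card_option, div_lt_one (by positivity)]
  have : (0 : ℝ) < Fintype.card α := by exact_mod_cast Fintype.card_pos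
  simp
  linarith

/-- Lift a subspace over `α` to one over `Option α`, putting `none` outside the support of `w`. -/
lemma exists_subspace_of_mask [Finite α] {a : α} {D : Set (ι → Option α)} (hD : Insens a D)
    (w : ι → Option α) (V : Combinatorics.Subspace η α ι)
    (hV : ∀ x, (fun e => (w e).map (fun _ => V x e)) ∈ D)
    (hw : ∀ e, ∃ i, (w i).isSome ∧ V.idxFun i = Sum.inr e) :
    ∃ W : Combinatorics.Subspace η (Option α) ι, ∀ x, W x ∈ D := by
  refine ⟨⟨fun i => (w i).elim (Sum.inl none) fun _ => (V.idxFun i).map some id, fun e => ?_⟩,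
    fun x => ?_⟩
  · obtain ⟨i, hi, hie⟩ := hw e
    obtain ⟨s, hs⟩ := Option.isSome_iff_exists.1 hi
    exact ⟨i, by simp [hs, hie]⟩
  · refine hD _ _ (fun i => ?_) (hV fun e => (x e).getD a)
    rw [Combinatorics.Subspace.apply_def, Combinatorics.Subspace.apply_def]
    cases hs : w i
    · simp [hs]
    · cases h : V.idxFun i <;> simp [hs, h]

/-- Dense insensitive sets contain subspaces. -/
lemma exists_subspace_of_insens [Finite α] (h : DHJ η α) (a : α) {β : ℝ} (hβ : 0 < β) :
    ∃ (ι : Type) (_ : Finite ι), ∀ D : Set (ι → Option α), Insens a D → β ≤ av (ind D) →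
      ∃ W : Combinatorics.Subspace η (Option α) ι, ∀ x, W x ∈ D := by
  have : Nonempty α := ⟨a⟩
  obtain ⟨J, _, hJ⟩ := h (β / 2) (by linarith)
  have := Fintype.ofFinite J
  set r := av (fun o : Option α => if o.isSome then (1 / 2 : ℝ) else 1) with hr
  have hr0 : 0 ≤ r := av_nonneg fun o => by split_ifs <;> norm_num
  obtain ⟨m, hm⟩ := exists_pow_lt_of_lt_one (show 0 < β / 2 / 2 ^ Fintype.card J by positivity)
    (av_half_lt_one (α := α))
  refine ⟨Fin m, inferInstance, fun D hD hDβ => ?_⟩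
  have hfew := av_ind_few_some (α := α) (ι := Fin m) (Fintype.card J)
  rw [Fintype.card_fin] at hfew
  rw [lt_div_iff₀' (by positivity)] at hm
  set B := {w : Fin m → Option α | (Finset.univ.filter fun e => (w e).isSome).card <
    Fintype.card J} with hB
  obtain ⟨w, hw⟩ := exists_av_le (fun w : Fin m → Option α =>
    av (fun y : Fin m → α => ind D (fun e => (w e).map (fun _ => y e))) - ind B w)
  rw [av_sub, av_mask] at hw
  have hwB : w ∉ B := by
    intro hwB
    rw [ind_of_mem hwB] at hw
    have : av (fun y : Fin m → α => ind D (fun e => (w e).map (fun _ => y e))) ≤ 1 :=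
      av_le_of_le zero_le_one fun y => ind_le_one _ _
    have : 0 < av (ind D) - av (ind B) := by linarith
    linarith
  rw [ind_of_notMem hwB, sub_zero] at hw
  have hcard : Fintype.card J ≤ Fintype.card {e // (w e).isSome} := by
    rw [Fintype.card_subtype]
    exact not_lt.1 hwB
  obtain ⟨g⟩ := Function.Embedding.nonempty_of_card_le hcard
  obtain ⟨V, hV, hVg⟩ := hJ.exists_of_injective (g := fun i => (g i : Fin m))
    (Subtype.val_injective.comp g.injective) {y | (fun e => (w e).map (fun _ => y e)) ∈ D}
    (le_trans (by linarith) (hw.trans (av_mono fun y => (ind_congr Iff.rfl).le)))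
  refine exists_subspace_of_mask hD w V hV fun e => ?_
  obtain ⟨i, hi⟩ := hVg e
  exact ⟨g i, (g i).2, hi⟩

end Insensitive

section Partition

variable {α η θ ι κ : Type}

lemma Insens.preimage {a : α} {D : Set (ι → Option α)} (hD : Insens a D)
    (W : Combinatorics.Subspace η (Option α) ι) : Insens a {x | W x ∈ D} := by
  refine fun x y hxy hx => hD _ _ (fun i => ?_) hx
  rw [Combinatorics.Subspace.apply_def, Combinatorics.Subspace.apply_def]
  cases h : W.idxFun i <;> simp [hxy]

/-- A function bounded above by `1` whose average on every `η`-dimensional subspace is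
nonpositive. -/
def NoExcess (η : Type) [Finite η] [Finite α] (φ : (ι → α) → ℝ) : Prop :=
  (∀ x, φ x ≤ 1) ∧ ∀ W : Combinatorics.Subspace η α ι, av (fun v => φ (W v)) ≤ 0

lemma NoExcess.comp [Finite η] [Finite α] {φ : (ι → α) → ℝ} (h : NoExcess η φ)
    (W : Combinatorics.Subspace θ α ι) : NoExcess η (fun v => φ (W v)) := by
  refine ⟨fun v => h.1 _, fun V => ?_⟩
  simp_rw [← comp_apply]
  exact h.2 _

lemma ind_mul_le_ind {X : Type} {φ : X → ℝ} (hφ : ∀ x, φ x ≤ 1) (D : Set X) (x : X) :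
    ind D x * φ x ≤ ind D x :=
  mul_le_of_le_one_right (ind_nonneg _ _) (hφ x)

/-- If dense insensitive sets contain subspaces, then an insensitive set can be exhausted by
subspaces up to an error decreasing geometrically. -/
lemma av_insens_mul_le_aux [Finite α] [Finite η] [Finite ι] {a : α} {β : ℝ} (hβ : 0 < β)
    (h : ∀ D : Set (ι → Option α), Insens a D → β / 2 ≤ av (ind D) →
      ∃ W : Combinatorics.Subspace η (Option α) ι, ∀ x, W x ∈ D) :
    ∃ r : ℝ, 0 ≤ r ∧ r < 1 ∧ ∀ T : ℕ, ∃ (κ : Type) (_ : Finite κ),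
      ∀ φ : (κ → Option α) → ℝ, NoExcess η φ → ∀ D, Insens a D →
        av (fun x => ind D x * φ x) ≤ β + r ^ T * av (ind D) := by
  set K := Nat.card (Combinatorics.Subspace η (Option α) ι) with hK
  set ρ : ℝ := Nat.card (η → Option α) / Nat.card (ι → Option α) with hρ
  have hρ0 : 0 < ρ := by
    have h1 : 0 < Nat.card (η → Option α) := Nat.card_pos
    have h2 : 0 < Nat.card (ι → Option α) := Nat.card_pos
    positivity
  set r := max 0 (1 - ρ * (β / (2 * (K + 1)))) with hr
  have hr0 : 0 ≤ r := le_max_left _ _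
  refine ⟨r, hr0, max_lt zero_lt_one (by linarith [show 0 < ρ * (β / (2 * (K + 1))) by positivity]),
    fun T => ?_⟩
  induction T with
  | zero =>
    refine ⟨Empty, inferInstance, fun φ hφ D hD => ?_⟩
    have := av_mono (ind_mul_le_ind hφ.1 D)
    linarith
  | succ T ih =>
    obtain ⟨κ, _, hκ⟩ := ih
    refine ⟨ι ⊕ κ, inferInstance, fun φ hφ D hD => ?_⟩
    have hd0 : 0 ≤ av (ind D) := av_nonneg (ind_nonneg D)
    rcases lt_or_ge (av (ind D)) β with hdβ | hdβ
    · have h1 := av_mono (ind_mul_le_ind hφ.1 D)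
      have : 0 ≤ r ^ (T + 1) * av (ind D) := by positivity
      linarith
    have hd := hdβ
    rw [av_sumElim, av_comm] at hd
    obtain ⟨hK0, W, hW⟩ := exists_event_of_av_ge hβ
      (fun z => av_le_of_le zero_le_one fun y => ind_le_one _ _) hd
      (fun (W : Combinatorics.Subspace η (Option α) ι) z => ∀ x, Sum.elim (W x) z ∈ D)
      (fun z hz => h {y | Sum.elim y z ∈ D}
        (fun x y hxy hx => hD _ _ (fun i => by cases i <;> simp [hxy]) hx)
        (hz.trans (av_mono fun y => (ind_congr Iff.rfl).le)))
    set Z := {z | ∀ x, Sum.elim (W x) z ∈ D} with hZ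
    set R := Set.range (W : (η → Option α) → ι → Option α) with hR
    let D' : (ι → Option α) → Set (κ → Option α) := fun y =>
      {z | Sum.elim y z ∈ D ∧ ¬ (y ∈ R ∧ z ∈ Z)}
    have hZi : Insens a Z := fun x y hxy hx v =>
      hD _ _ (fun i => by cases i <;> simp [hxy]) (hx v)
    have hD'i : ∀ y, Insens a (D' y) := by
      refine fun y z z' hzz hz => ⟨hD _ _ (fun i => by cases i <;> simp [hzz]) hz.1, fun hy => ?_⟩
      exact hz.2 ⟨hy.1, hZi _ _ (fun i => (hzz i).symm) hy.2⟩
    have hsplit : ∀ y z, ind D (Sum.elim y z) = ind (D' y) z + ind R y * ind Z z := by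
      intro y z
      by_cases hyz : y ∈ R ∧ z ∈ Z
      · have h1 : Sum.elim y z ∈ D := by
          obtain ⟨⟨v, rfl⟩, hz⟩ := hyz
          exact hz v
        rw [ind_of_mem h1, ind_of_notMem (fun hz : z ∈ D' y => hz.2 hyz), ind_of_mem hyz.1,
          ind_of_mem hyz.2]
        norm_num
      · have h1 : ind R y * ind Z z = 0 := by
          by_cases hy : y ∈ R
          · rw [ind_of_notMem (fun hz => hyz ⟨hy, hz⟩), mul_zero]
          · rw [ind_of_notMem hy, zero_mul]
        rw [h1, add_zero]
        exact ind_congr ⟨fun h => ⟨h, hyz⟩, fun h => h.1⟩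
    have hWinj := subspace_injective W
    have hdens : av (fun y => av (ind (D' y))) = av (ind D) - ρ * av (ind Z) := by
      rw [av_sumElim (ind D)]
      simp_rw [hsplit, av_add, av_const_mul]
      rw [av_ind_range hWinj, av_const]
      ring
    have hsecond : av (fun y => ind R y * av (fun z => ind Z z * φ (Sum.elim y z))) ≤ 0 := by
      rw [av_ind_range hWinj, av_comm]
      refine mul_nonpos_of_nonneg_of_nonpos hρ0.le (av_le_of_le le_rfl fun z => ?_)
      rw [av_const_mul]
      refine mul_nonpos_of_nonneg_of_nonpos (ind_nonneg _ _) ?_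
      simp_rw [← horizontal_apply]
      exact hφ.2 _
    have hfirst : av (fun y => av (fun z => ind (D' y) z * φ (Sum.elim y z))) ≤
        β + r ^ T * (av (ind D) - ρ * av (ind Z)) := by
      rw [← hdens, ← av_const_mul, ← av_const (X := ι → Option α) β, ← av_add]
      refine av_mono fun y => hκ _ ⟨fun z => hφ.1 _, fun V => ?_⟩ _ (hD'i y)
      simp_rw [← vertical_apply]
      exact hφ.2 _
    have hsum : av (fun x => ind D x * φ x) =
        av (fun y => av (fun z => ind (D' y) z * φ (Sum.elim y z))) +
          av (fun y => ind R y * av (fun z => ind Z z * φ (Sum.elim y z))) := by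
      rw [av_sumElim]
      simp_rw [hsplit, ← av_const_mul, ← av_add]
      refine congrArg _ (funext fun y => congrArg _ (funext fun z => ?_))
      ring
    have hZ0 : β / (2 * (K + 1)) ≤ av (ind Z) := by
      refine le_trans ?_ hW
      rw [← hK] at hK0 ⊢
      have : (0 : ℝ) < K := by exact_mod_cast hK0
      gcongr
      linarith
    have hdec : av (ind D) - ρ * av (ind Z) ≤ r * av (ind D) := by
      have h1 : ρ * (β / (2 * (K + 1))) ≤ ρ * av (ind Z) := by gcongr
      have h2 : (1 - ρ * (β / (2 * (K + 1)))) * av (ind D) ≤ r * av (ind D) := by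
        gcongr
        exact le_max_right _ _
      have h3 : ρ * (β / (2 * (K + 1))) * av (ind D) ≤ ρ * (β / (2 * (K + 1))) :=
        mul_le_of_le_one_right (by positivity) (av_ind_le_one D)
      linarith
    have h4 : r ^ T * (av (ind D) - ρ * av (ind Z)) ≤ r ^ T * (r * av (ind D)) := by gcongr
    rw [hsum, pow_succ, mul_assoc]
    linarith

lemma av_insens_mul_le [Finite α] [Finite η] (h : DHJ η α) (a : α) {β : ℝ} (hβ : 0 < β) :
    ∃ (κ : Type) (_ : Finite κ), ∀ φ : (κ → Option α) → ℝ, NoExcess η φ →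
      ∀ D, Insens a D → av (fun x => ind D x * φ x) ≤ β := by
  obtain ⟨ι, _, hι⟩ := exists_subspace_of_insens h a (show 0 < β / 2 / 2 by linarith)
  obtain ⟨r, hr0, hr1, hr⟩ := av_insens_mul_le_aux (show 0 < β / 2 by linarith) hι
  obtain ⟨T, hT⟩ := exists_pow_lt_of_lt_one (show 0 < β / 2 by linarith) hr1
  obtain ⟨κ, _, hκ⟩ := hr T
  refine ⟨κ, inferInstance, fun φ hφ D hD => (hκ φ hφ D hD).trans ?_⟩
  have : r ^ T * av (ind D) ≤ r ^ T :=
    mul_le_of_le_one_right (by positivity) (av_ind_le_one D)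
  linarith

lemma av_iInter_mul_le [Finite α] (h : DHJ Unit α) (s : Finset α) :
    ∀ (η : Type) [Finite η] (β : ℝ), 0 < β → ∃ (κ : Type) (_ : Finite κ),
      ∀ φ : (κ → Option α) → ℝ, NoExcess η φ → ∀ D : α → Set (κ → Option α),
        (∀ i ∈ s, Insens i (D i)) → av (fun x => ind (⋂ i ∈ s, D i) x * φ x) ≤ β := by
  classical
  induction s using Finset.induction_on with
  | empty =>
    intro η _ β hβ
    refine ⟨η, inferInstance, fun φ hφ D _ => ?_⟩
    have h1 := hφ.2 default
    have h2 : ∀ x : η → Option α, (default : Combinatorics.Subspace η (Option α) η) x = x :=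
      fun x => rfl
    simp_rw [h2] at h1
    simpa [ind] using h1.trans hβ.le
  | insert i s _ ih =>
    intro η _ β hβ
    obtain ⟨θ, _, hθ⟩ := ih η (β / 2) (by linarith)
    obtain ⟨κ, _, hκ⟩ := av_insens_mul_le (h.multidim θ) i (show 0 < β / 2 by linarith)
    refine ⟨κ, inferInstance, fun φ hφ D hD => ?_⟩
    have h1 := hκ (fun x => ind (⋂ j ∈ s, D j) x * φ x - β / 2) ⟨fun x => ?_, fun W => ?_⟩ (D i)
      (hD i (Finset.mem_insert_self i s))
    · have h2 : ∀ x, ind (⋂ j ∈ insert i s, D j) x * φ x =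
          ind (D i) x * (ind (⋂ j ∈ s, D j) x * φ x - β / 2) + β / 2 * ind (D i) x := by
        intro x
        have : ind (⋂ j ∈ insert i s, D j) x = ind (D i) x * ind (⋂ j ∈ s, D j) x := by
          rw [Finset.set_biInter_insert]
          simp only [ind, Set.inter_indicator_one, Pi.mul_apply]
        rw [this]
        ring
      simp_rw [h2]
      rw [av_add, av_const_mul]
      have : β / 2 * av (ind (D i)) ≤ β / 2 :=
        mul_le_of_le_one_right (by linarith) (av_ind_le_one _)
      linarith
    · have := (ind_mul_le_ind hφ.1 (⋂ j ∈ s, D j) x).trans (ind_le_one _ _)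
      linarith
    · rw [av_sub, av_const, sub_nonpos]
      refine le_trans (av_mono fun v => ?_) (hθ _ (hφ.comp W) (fun j => {v | W v ∈ D j})
        fun j hj => (hD j (Finset.mem_insert_of_mem hj)).preimage W)
      rw [ind_congr (B := ⋂ j ∈ s, {v | W v ∈ D j}) (y := v)]
      simp

/-- A function without excess on subspaces has small sum outside an intersection of insensitive
sets. -/
lemma av_compl_iInter_mul_le [Fintype α] (h : DHJ Unit α) (η : Type) [Finite η] {β : ℝ}
    (hβ : 0 < β) : ∃ (κ : Type) (_ : Finite κ),
      ∀ φ : (κ → Option α) → ℝ, NoExcess η φ → ∀ D : α → Set (κ → Option α),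
        (∀ i, Insens i (D i)) →
          av (fun x => (1 - ind (⋂ i, D i) x) * φ x) ≤ Fintype.card α * β := by
  classical
  obtain ⟨κ, _, hκ⟩ := av_iInter_mul_le h Finset.univ η β hβ
  refine ⟨κ, inferInstance, fun φ hφ D hD => ?_⟩
  have key : ∀ s : Finset α,
      av (fun x => (1 - ind (⋂ i ∈ s, D i) x) * φ x) ≤ s.card * β := by
    intro s
    induction s using Finset.induction_on with
    | empty => simp [ind, av]
    | insert i s his ih =>
      have h1 := hκ φ hφ (fun j => if j ∈ s then D j else if j = i then (D i)ᶜ else Set.univ)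
        fun j _ => by
          split_ifs with h1 h2
          · exact hD j
          · subst h2
            exact fun x y hxy hx hy => hx (hD j _ _ (fun k => (hxy k).symm) hy)
          · exact fun _ _ _ _ => trivial
      have h2 : ∀ x, (1 - ind (⋂ j ∈ insert i s, D j) x) * φ x =
          (1 - ind (⋂ j ∈ s, D j) x) * φ x + ind (⋂ j ∈ Finset.univ,
            if j ∈ s then D j else if j = i then (D i)ᶜ else Set.univ) x * φ x := by
        intro x
        have h3 : ind (⋂ j ∈ Finset.univ,
            if j ∈ s then D j else if j = i then (D i)ᶜ else Set.univ) x =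
            ind ((D i)ᶜ ∩ ⋂ j ∈ s, D j) x := by
          refine ind_congr ?_
          simp only [Finset.mem_univ, Set.iInter_true, Set.mem_iInter, Set.mem_inter_iff]
          refine ⟨fun hx => ⟨by simpa [his] using hx i, fun j hj => by simpa [hj] using hx j⟩,
            fun hx j => ?_⟩
          split_ifs with h1 h2
          · exact hx.2 j h1
          · exact hx.1
          · trivial
        rw [h3, Finset.set_biInter_insert]
        simp only [ind, Set.inter_indicator_one, Pi.mul_apply, Set.indicator_compl, Pi.sub_apply,
          Pi.one_apply]
        ring
      simp_rw [h2]
      rw [av_add, Finset.card_insert_of_notMem his]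
      push_cast
      linarith
  simpa using key Finset.univ

end Partition

section Ramsey

variable {α η θ ι κ : Type}

/-- A subspace over `α`, viewed over the alphabet `Option α`. -/
def lift (V : Combinatorics.Subspace η α ι) : Combinatorics.Subspace η (Option α) ι where
  idxFun i := (V.idxFun i).map some id
  proper e := by
    obtain ⟨i, hi⟩ := V.proper e
    exact ⟨i, by simp [hi]⟩

lemma lift_apply (V : Combinatorics.Subspace η α ι) (x : η → Option α) (i : ι) :
    lift V x i = (V.idxFun i).elim some x := by
  rw [Combinatorics.Subspace.apply_def]
  cases h : V.idxFun i <;> simp [lift, h]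

/-- Replace the constant letters `none` of a subspace over `Option α` by `a`. -/
def fill (a : α) (U : Combinatorics.Subspace η (Option α) ι) : Combinatorics.Subspace η α ι where
  idxFun i := (U.idxFun i).map (fun s => s.getD a) id
  proper e := by
    obtain ⟨i, hi⟩ := U.proper e
    exact ⟨i, by simp [hi]⟩

/-- Compose a subspace `U` over `Option α` with a subspace `V` over `α`, using an additional
variable, which also takes the place of the constant letters `none` of `U`. -/
def starComp (U : Combinatorics.Subspace κ (Option α) ι)
    (V : Combinatorics.Subspace (θ ⊕ η) α κ) :
    Combinatorics.Subspace (Option θ ⊕ η) α (Option ι) where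
  idxFun o := o.elim (Sum.inr (Sum.inl none)) fun i =>
    (U.idxFun i).elim (fun s => s.elim (Sum.inr (Sum.inl none)) Sum.inl)
      fun e => (V.idxFun e).map id (Sum.map some id)
  proper e := by
    rcases e with (_ | e) | e
    · exact ⟨none, rfl⟩
    · obtain ⟨j, hj⟩ := V.proper (Sum.inl e)
      obtain ⟨i, hi⟩ := U.proper j
      exact ⟨some i, by simp [hi, hj]⟩
    · obtain ⟨j, hj⟩ := V.proper (Sum.inr e)
      obtain ⟨i, hi⟩ := U.proper j
      exact ⟨some i, by simp [hi, hj]⟩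

lemma lift_starComp_of_none (U : Combinatorics.Subspace κ (Option α) ι)
    (V : Combinatorics.Subspace (θ ⊕ η) α κ) {t : Option θ → Option α} (b : η → Option α)
    (ht : t none = none) :
    lift (starComp U V) (Sum.elim t b) =
      fun o => o.elim none (U (lift V (Sum.elim (fun e => t (some e)) b))) := by
  ext1 o
  rw [lift_apply]
  rcases o with _ | i
  · simp [starComp, ht]
  · rw [Option.elim_some, Combinatorics.Subspace.apply_def]
    rcases h : U.idxFun i with (_ | s) | j
    · simp [starComp, h, ht]
    · simp [starComp, h]
    · rw [Sum.elim_inr, lift_apply]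
      rcases h' : V.idxFun j with s | j' | j' <;> simp [starComp, h, h']

lemma lift_starComp_of_some (U : Combinatorics.Subspace κ (Option α) ι)
    (V : Combinatorics.Subspace (θ ⊕ η) α κ) {t : Option θ → Option α} (b : η → Option α)
    {a : α} (ht : t none = some a) :
    lift (starComp U V) (Sum.elim t b) =
      fun o => o.elim (some a)
        (lift (fill a U) (lift V (Sum.elim (fun e => t (some e)) b))) := by
  ext1 o
  rw [lift_apply]
  rcases o with _ | i
  · simp [starComp, ht]
  · rw [Option.elim_some, lift_apply]
    rcases h : U.idxFun i with (_ | s) | j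
    · simp [starComp, fill, h, ht]
    · simp [starComp, fill, h]
    · simp only [fill, h, Sum.map_inr, Sum.elim_inr, id, lift_apply]
      rcases h' : V.idxFun j with s | j' | j' <;> simp [starComp, h, h']

/-- A Ramsey theorem of Graham-Rothschild type: the color of a word in a suitable subspace does
not depend on the last coordinates as soon as one of the first coordinates is `none`. -/
lemma exists_subspace_color_eq [Finite α] [Finite η] (θ : Type) [Finite θ] :
    ∀ (κ : Type) [Finite κ], ∃ (ι : Type) (_ : Finite ι), ∀ c : (ι → Option α) → κ,
      ∃ V : Combinatorics.Subspace (θ ⊕ η) α ι, ∀ t : θ → Option α, ∀ e, t e = none →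
        ∀ b b' : η → Option α, c (lift V (Sum.elim t b)) = c (lift V (Sum.elim t b')) := by
  induction θ using Finite.induction_empty_option with
  | of_equiv e ih =>
    intro κ _
    obtain ⟨ι, _, hι⟩ := ih κ
    refine ⟨ι, inferInstance, fun c => ?_⟩
    obtain ⟨V, hV⟩ := hι c
    refine ⟨V.reindex (e.sumCongr (Equiv.refl _)) (Equiv.refl _) (Equiv.refl _), ?_⟩
    intro t e' ht b b'
    have key : ∀ b, lift (V.reindex (e.sumCongr (Equiv.refl _)) (Equiv.refl _) (Equiv.refl _))
        (Sum.elim t b) = lift V (Sum.elim (t ∘ e) b) := by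
      intro b
      ext1 i
      rw [lift_apply, lift_apply]
      rcases h : V.idxFun i with s | j | j <;> simp [Combinatorics.Subspace.reindex, h]
    rw [key, key]
    exact hV _ (e.symm e') (by simpa using ht) _ _
  | h_empty =>
    exact fun κ _ => ⟨PEmpty ⊕ η, inferInstance, fun c => ⟨default, fun t e => e.elim⟩⟩
  | h_option ih =>
    intro κ _
    obtain ⟨ι', _, hι'⟩ := ih (α → κ)
    obtain ⟨ι, _, hι⟩ := Combinatorics.Subspace.exists_mono_in_high_dimension (Option α) κ ι'
    refine ⟨Option ι, inferInstance, fun c => ?_⟩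
    obtain ⟨U, k, hU⟩ := hι fun u => c fun o => o.elim none u
    obtain ⟨V, hV⟩ := hι' fun u a => c fun o => o.elim (some a) (lift (fill a U) u)
    refine ⟨starComp U V, fun t e ht b b' => ?_⟩
    rcases hn : t none with _ | a
    · rw [lift_starComp_of_none U V b hn, lift_starComp_of_none U V b' hn]
      exact (hU _).trans (hU _).symm
    · rw [lift_starComp_of_some U V b hn, lift_starComp_of_some U V b' hn]
      rcases e with _ | e
      · rw [hn] at ht
        exact absurd ht (by simp)
      · exact congrFun (hV (fun e => t (some e)) e ht b b') a

end Ramsey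

section Increment

variable {α η θ ι κ : Type}

lemma some_getD_lift (V : Combinatorics.Subspace η α ι) (a : α) (x : η → Option α) (i : ι) :
    some ((lift V x i).getD a) = lift V (fun j => some ((x j).getD a)) i := by
  rw [lift_apply, lift_apply]
  cases h : V.idxFun i <;> simp

/-- A word over `Option α` containing `none` spans a line whose points are the word itself and
the words obtained by replacing `none` by letters of `α`. -/
lemma exists_line_of_word {A : Set (ι → Option α)} {y : ι → Option α} (hy : ∃ i, y i = none)
    (hyA : y ∈ A) (h : ∀ a, (fun i => some ((y i).getD a)) ∈ A) :
    ∃ L : Combinatorics.Subspace Unit (Option α) ι, ∀ x, L x ∈ A := by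
  refine ⟨⟨fun i => (y i).elim (Sum.inr ()) fun s => Sum.inl (some s), fun e => ?_⟩, fun x => ?_⟩
  · obtain ⟨i, hi⟩ := hy
    exact ⟨i, by simp [hi]⟩
  · rcases hx : x () with _ | a
    · convert hyA using 1
      ext1 i
      rw [Combinatorics.Subspace.apply_def]
      cases hi : y i <;> simp [hi, hx]
    · convert h a using 1
      ext1 i
      rw [Combinatorics.Subspace.apply_def]
      cases hi : y i <;> simp [hi, hx]

lemma sub_card_mul_le {X : Type} [Finite X] {f : X → ℝ} {s : ℝ} (h : ∀ x, f x ≤ s) (x : X) :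
    s - Nat.card X * (s - av f) ≤ f x := by
  have : Nonempty X := ⟨x⟩
  have := Fintype.ofFinite X
  have h1 : s - f x ≤ ∑ x, (s - f x) :=
    Finset.single_le_sum (f := fun x => s - f x) (fun y _ => sub_nonneg.2 (h y))
      (Finset.mem_univ x)
  rw [Finset.sum_sub_distrib, Finset.sum_const, Finset.card_univ, nsmul_eq_mul] at h1
  have h2 : (Fintype.card X : ℝ) * av f = ∑ x, f x := by
    rw [av_eq, mul_div_cancel₀ _ (by positivity)]
  rw [Nat.card_eq_fintype_card]
  linarith

lemma le_av {X : Type} [Finite X] [Nonempty X] {f : X → ℝ} {c : ℝ} (h : ∀ x, c ≤ f x) :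
    c ≤ av f :=
  (av_const (X := X) c).symm.le.trans (av_mono h)

/-- A set without lines has no excess on subspaces, relative to a density that forces lines. -/
lemma noExcess_of_no_line [Finite α] [Finite η] {s : ℝ} (hs : 0 ≤ s)
    (hη : Forces Unit α s η) {A : Set (ι → α)}
    (hA : ¬ ∃ L : Combinatorics.Subspace Unit α ι, ∀ x, L x ∈ A) :
    NoExcess η (fun x => ind A x - s) := by
  refine ⟨fun x => by linarith [ind_le_one A x], fun W => ?_⟩
  by_contra! h
  rcases isEmpty_or_nonempty (η → α) with hα | hα
  · simp [av] at h
  rw [av_sub, av_const] at h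
  obtain ⟨K, hK⟩ := hη {v | W v ∈ A} (by
    refine le_trans ?_ (av_mono fun v => (ind_congr (Iff.rfl : W v ∈ A ↔ v ∈ {v | W v ∈ A})).le)
    linarith)
  exact hA ⟨comp W K, fun x => by rw [comp_apply]; exact hK x⟩

/-- Almost all slices of a line-free set of critical density are dense, and so some subspace of
the first coordinates is spanned by words for which the set of common extensions of the
associated points is dense. -/
lemma exists_subspace_common_dense [Finite α] [Nonempty α] [Finite η] {δ : ℝ} (hδ : 0 < δ)
    {J : Type} [Finite J] (hJ : Forces Unit α (δ / 2) J) :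
    ∃ (ι : Type) (_ : Finite ι), ∀ (κ : Type) [Finite κ] (A : Set (ι ⊕ κ → Option α)),
      (∀ y, δ ≤ av (fun x => ind A (Sum.elim y x))) →
        ∃ (V : Combinatorics.Subspace (J ⊕ η) α ι) (t : J → Option α), (∃ e, t e = none) ∧
          ∀ b : η → Option α, δ / (2 * (Nat.card (Combinatorics.Subspace Unit α J) + 1)) ≤
            av (ind {x | ∀ a, Sum.elim
              (fun i => some ((lift V (Sum.elim t b) i).getD a)) x ∈ A}) := by
  obtain ⟨ι, _, hι⟩ := exists_subspace_color_eq (α := α) (η := η) J Prop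
  refine ⟨ι, inferInstance, fun κ _ A hA => ?_⟩
  obtain ⟨V, hV⟩ := hι fun y => δ / (2 * (Nat.card (Combinatorics.Subspace Unit α J) + 1)) ≤
    av (ind {x | ∀ a, Sum.elim (fun i => some ((y i).getD a)) x ∈ A})
  let s : α := Classical.arbitrary α
  have hav : δ ≤ av (fun x : κ → Option α => av (fun y : J → α =>
      ind A (Sum.elim (lift V (Sum.elim (fun j => some (y j)) fun _ => some s)) x))) := by
    rw [av_comm]
    exact le_av fun y => hA _
  obtain ⟨hN, L, hL⟩ := exists_event_of_av_ge hδ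
    (fun x => av_le_of_le zero_le_one fun y => ind_le_one _ _) hav
    (fun (L : Combinatorics.Subspace Unit α J) x => ∀ v,
      Sum.elim (lift V (Sum.elim (fun j => some (L v j)) fun _ => some s)) x ∈ A)
    (fun x hx => hJ {y | Sum.elim (lift V (Sum.elim (fun j => some (y j)) fun _ => some s)) x ∈ A}
      (hx.trans (av_mono fun y => (ind_congr Iff.rfl).le)))
  have hN' : (0 : ℝ) < Nat.card (Combinatorics.Subspace Unit α J) := by exact_mod_cast hN
  have hL' := le_trans (show δ / (2 * (Nat.card (Combinatorics.Subspace Unit α J) + 1)) ≤ _ by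
    gcongr; linarith) hL
  obtain ⟨e, he⟩ := L.proper ()
  set t : J → Option α := fun j => (L.idxFun j).elim some fun _ => none with ht
  have hte : t e = none := by simp [ht, he]
  refine ⟨V, t, ⟨e, hte⟩, fun b => ?_⟩
  refine (hV t e hte (fun _ => some s) b).mp (hL'.trans (av_mono fun x => ?_))
  by_cases hx : x ∈ {x | ∀ v,
      Sum.elim (lift V (Sum.elim (fun j => some (L v j)) fun _ => some s)) x ∈ A}
  · rw [ind_of_mem hx, ind_of_mem]
    intro a
    have : (fun i => some ((lift V (Sum.elim t fun _ => some s) i).getD a)) =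
        lift V (Sum.elim (fun j => some (L (fun _ => a) j)) fun _ => some s) := by
      ext1 i
      rw [some_getD_lift]
      congr 2
      ext1 j
      rcases j with j | j
      · rw [Sum.elim_inl, Sum.elim_inl, Combinatorics.Subspace.apply_def]
        cases h : L.idxFun j <;> simp [ht, h]
      · rfl
    rw [this]
    exact hx _
  · rw [ind_of_notMem hx]
    exact ind_nonneg _ _

/-- The density increment: the infimum of the densities forcing lines cannot be positive. -/
lemma exists_forces_sub [Finite α] [Nonempty α] (h : DHJ Unit α) {δ : ℝ} (hδ : 0 < δ) :
    ∃ γ > 0, ∀ (η : Type) [Finite η], Forces Unit (Option α) (δ + γ) η →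
      ∃ (ι : Type) (_ : Finite ι) (γ' : ℝ), 0 < γ' ∧ γ' < δ ∧ ∀ (κ : Type) [Finite κ],
        Forces Unit (Option α) (δ + γ') κ → Forces Unit (Option α) (δ - γ') (ι ⊕ κ) := by
  have := Fintype.ofFinite α
  obtain ⟨J, _, hJ⟩ := h (δ / 2 / 2) (by linarith)
  set τ : ℝ := δ / 2 / (2 * (Nat.card (Combinatorics.Subspace Unit α J) + 1)) with hτ
  have hτ0 : 0 < τ := by positivity
  set γ := min (τ * δ / 8) (δ / 2) with hγ
  have hγ0 : 0 < γ := by positivity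
  have hγ1 : γ ≤ τ * δ / 8 := min_le_left _ _
  have hγ2 : γ ≤ δ / 2 := min_le_right _ _
  refine ⟨γ, hγ0, fun η _ hη => ?_⟩
  set k : ℝ := (Fintype.card α : ℝ) with hk
  obtain ⟨M, _, hM⟩ := av_compl_iInter_mul_le h η
    (show 0 < τ * δ / (2 * (k + 1)) by positivity)
  obtain ⟨ι, _, hι⟩ := exists_subspace_common_dense (η := M) (half_pos hδ) hJ
  have hcard : 0 < Nat.card (ι → Option α) := Nat.card_pos
  have hcard1 : (1 : ℝ) ≤ Nat.card (ι → Option α) := by exact_mod_cast hcard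
  set γ' := γ / (2 * Nat.card (ι → Option α)) with hγ'
  have hγ'0 : 0 < γ' := by positivity
  have hγ'1 : γ' * (2 * Nat.card (ι → Option α)) = γ := by
    rw [hγ', div_mul_cancel₀ _ (by positivity)]
  have hγ'2 : γ' < δ := by nlinarith
  refine ⟨ι, inferInstance, γ', hγ'0, hγ'2, fun κ _ hκ A hA => ?_⟩
  by_contra hno
  have hslice : ∀ y, av (fun x => ind A (Sum.elim y x)) ≤ δ + γ' := by
    intro y
    by_contra! hy
    obtain ⟨V, hV⟩ := hκ {x | Sum.elim y x ∈ A}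
      (hy.le.trans (av_mono fun x => (ind_congr Iff.rfl).le))
    exact hno ⟨vertical y V, fun x => by rw [vertical_apply]; exact hV x⟩
  have hdense : ∀ y, δ - γ ≤ av (fun x => ind A (Sum.elim y x)) := by
    intro y
    have h1 := sub_card_mul_le hslice y
    rw [← av_sumElim] at h1
    have h2 : Nat.card (ι → Option α) * (δ + γ' - av (ind A)) ≤
        Nat.card (ι → Option α) * (2 * γ') := by gcongr; linarith
    linarith
  obtain ⟨V, t, ⟨e, hte⟩, hVt⟩ := hι κ A fun y => by linarith [hdense y]
  obtain ⟨i₀, hi₀⟩ := V.proper (Sum.inl e)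
  let U := comp (lift V) (vertical t (default : Combinatorics.Subspace M (Option α) M))
  have hU : ∀ b, U b = lift V (Sum.elim t b) := fun b => by
    rw [comp_apply, vertical_apply]; rfl
  let D : (κ → Option α) → α → Set (M → Option α) := fun x a =>
    {b | Sum.elim (fun i => some ((U b i).getD a)) x ∈ A}
  let A' : (κ → Option α) → Set (M → Option α) := fun x => {b | Sum.elim (U b) x ∈ A}
  have hD : ∀ x a, Insens a (D x a) := by
    intro x a b b' hbb hb
    have : (fun i => some ((U b' i).getD a)) = fun i => some ((U b i).getD a) := by
      ext1 i
      rw [hU, hU, some_getD_lift, some_getD_lift]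
      congr 2
      ext1 j
      rcases j with j | j <;> simp [hbb]
    change Sum.elim (fun i => some ((U b' i).getD a)) x ∈ A
    rw [this]
    exact hb
  have hdisj : ∀ x b, b ∈ A' x → b ∉ ⋂ a, D x a := by
    intro x b hb hbD
    rw [Set.mem_iInter] at hbD
    obtain ⟨L, hL⟩ := exists_line_of_word (A := {y | Sum.elim y x ∈ A}) (y := U b)
      ⟨i₀, by rw [hU, lift_apply, hi₀]; exact hte⟩ hb hbD
    exact hno ⟨horizontal L x, fun v => by rw [horizontal_apply]; exact hL v⟩
  obtain ⟨x, hx⟩ := exists_av_le fun x => av (ind (A' x)) -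
    (δ + γ) * (1 - av (ind (⋂ a, D x a)))
  have hA' : δ - γ ≤ av (fun x => av (ind (A' x))) := by
    rw [av_comm]
    exact le_av fun b => (hdense (U b)).trans (av_mono fun x => (ind_congr Iff.rfl).le)
  have hC : τ ≤ av (fun x => av (ind (⋂ a, D x a))) := by
    rw [av_comm]
    refine le_av fun b => (hVt b).trans (av_mono fun x => (ind_congr ?_).le)
    simp [D, hU]
  rw [av_sub, av_const_mul, av_sub, av_const] at hx
  have hφ : NoExcess η (fun b => ind (A' x) b - (δ + γ)) := by
    refine noExcess_of_no_line (by linarith) hη ?_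
    rintro ⟨L, hL⟩
    exact hno ⟨horizontal (comp U L) x, fun v => by
      rw [horizontal_apply, comp_apply]; exact hL v⟩
  have hfin := hM _ hφ (D x) (hD x)
  have hpt : ∀ b, (1 - ind (⋂ a, D x a) b) * (ind (A' x) b - (δ + γ)) =
      ind (A' x) b - (δ + γ) * (1 - ind (⋂ a, D x a) b) := by
    intro b
    by_cases hb : b ∈ A' x
    · rw [ind_of_notMem (hdisj x b hb)]
      ring
    · rw [ind_of_notMem hb]
      ring
  simp_rw [hpt] at hfin
  rw [av_sub, av_const_mul, av_sub, av_const, ← hk] at hfin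
  have h1 : k * (τ * δ / (2 * (k + 1))) ≤ τ * δ / 2 := by
    rw [mul_div_assoc', div_le_div_iff₀ (by positivity) (by norm_num)]
    have : 0 ≤ τ * δ := by positivity
    nlinarith
  have h2 : (δ + γ) * (1 - av (fun x => av (ind (⋂ a, D x a)))) ≤ (δ + γ) * (1 - τ) := by
    gcongr
  nlinarith [mul_pos hγ0 hτ0, mul_pos hτ0 hδ]

lemma DHJ.option_alphabet [Finite α] (h : DHJ Unit α) : DHJ Unit (Option α) := by
  rcases isEmpty_or_nonempty α with hα | hα
  · refine fun δ hδ => ⟨Unit, inferInstance, fun A hA => ?_⟩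
    obtain ⟨x, hx⟩ := exists_pos_of_av_pos (hδ.trans_le hA)
    have hxA : x ∈ A := by
      by_contra h
      rw [ind_of_notMem h] at hx
      exact lt_irrefl _ hx
    exact ⟨default, fun y => by
      have : (default : Combinatorics.Subspace Unit (Option α) Unit) y = x :=
        Subsingleton.elim _ _
      rwa [this]⟩
  set S := {δ : ℝ | 0 < δ ∧ ∃ (ι : Type) (_ : Finite ι), Forces Unit (Option α) δ ι} with hS
  have h2 : (2 : ℝ) ∈ S :=
    ⟨by norm_num, Unit, inferInstance, fun A hA => absurd (av_ind_le_one A) (by linarith)⟩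
  have hup : ∀ δ ∈ S, ∀ δ', δ ≤ δ' → δ' ∈ S := by
    rintro δ ⟨hδ, ι, _, hι⟩ δ' h
    exact ⟨hδ.trans_le h, ι, inferInstance, fun A hA => hι A (h.trans hA)⟩
  have hbdd : BddBelow S := ⟨0, fun δ hδ => hδ.1.le⟩
  have hgt : ∀ δ, sInf S < δ → δ ∈ S := by
    intro δ hδ
    obtain ⟨δ', h1, h2⟩ := exists_lt_of_csInf_lt ⟨2, h2⟩ hδ
    exact hup δ' h1 δ h2.le
  rcases (le_csInf ⟨2, h2⟩ fun δ hδ => hδ.1.le : 0 ≤ sInf S).eq_or_lt with h0 | h0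
  · exact fun δ hδ => (hgt δ (h0 ▸ hδ)).2
  · obtain ⟨γ, hγ, hγS⟩ := exists_forces_sub h h0
    obtain ⟨-, η, _, hη⟩ := hgt (sInf S + γ) (by linarith)
    obtain ⟨ι, _, γ', hγ', hγ'', hsub⟩ := hγS η hη
    obtain ⟨-, κ, _, hκ⟩ := hgt (sInf S + γ') (by linarith)
    have h3 : sInf S - γ' ∈ S := ⟨by linarith, ι ⊕ κ, inferInstance, hsub κ hκ⟩
    have := csInf_le hbdd h3
    linarith

/-- The density Hales-Jewett theorem. -/
lemma dhj (α : Type) [hα : Finite α] : DHJ Unit α := by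
  refine Finite.induction_empty_option (P := fun α => ∀ _ : Finite α, DHJ Unit α)
    (fun {α β} e ih _ δ hδ => ?_) (fun _ δ hδ => ?_) (fun {α} _ ih _ => ?_) α hα
  · have : Finite α := Finite.of_equiv β e.symm
    obtain ⟨ι, _, hι⟩ := ih this δ hδ
    refine ⟨ι, inferInstance, fun A hA => ?_⟩
    rw [← av_equiv (Equiv.arrowCongr (Equiv.refl ι) e)] at hA
    obtain ⟨V, hV⟩ := hι {x | e ∘ x ∈ A} (hA.trans (av_mono fun x => (ind_congr Iff.rfl).le))
    refine ⟨V.reindex (Equiv.refl _) e (Equiv.refl _), fun x => ?_⟩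
    have : V.reindex (Equiv.refl _) e (Equiv.refl _) x = e ∘ V (e.symm ∘ x) := by
      ext1 i
      simp [Combinatorics.Subspace.reindex_apply]
    rw [this]
    exact hV _
  · refine ⟨Unit, inferInstance, fun A hA => ?_⟩
    simp [av] at hA
    linarith
  · have : Finite α := Fintype.finite inferInstance
    exact (ih this).option_alphabet

end Increment

end DensityHalesJewett

namespace ErdosStoneGeometries

open DensityHalesJewett

lemma av_ind_eq_ncard_div {X : Type*} [Finite X] (A : Set X) :
    av (ind A) = A.ncard / Nat.card X := by
  classical
  have := Fintype.ofFinite X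
  rw [av_eq, Nat.card_eq_fintype_card, Set.ncard_eq_toFinset_card']
  simp [ind, Set.indicator_apply, Finset.sum_boole, Set.toFinset_card, Fintype.card_subtype]

variable {F : Type} [Field F] {E : Type} [AddCommGroup E] [Module F E]

/-- The families of `i` vectors having no nontrivial linear combination in `B`. -/
def avoiding (F : Type) [Field F] {E : Type} [AddCommGroup E] [Module F E] (B : Set E) (i : ℕ) :
    Set (Fin i → E) :=
  {v | ∀ a : Fin i → F, a ≠ 0 → ∑ j, a j • v j ∉ B}

lemma ncard_cons_notMem_avoiding_le [Fintype F] [Finite E] {B : Set E}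
    (hB : ∀ (a : F) (v : E), a ≠ 0 → v ∈ B → a • v ∈ B) {i : ℕ} {v : Fin i → E}
    (hv : v ∈ avoiding F B i) :
    {w : E | (Fin.cons w v : Fin (i + 1) → E) ∉ avoiding F B (i + 1)}.ncard ≤
      B.ncard * Fintype.card F ^ i := by
  have hsub : {w : E | (Fin.cons w v : Fin (i + 1) → E) ∉ avoiding F B (i + 1)} ⊆
      (fun p : E × (Fin i → F) => p.1 - ∑ j, p.2 j • v j) '' (B ×ˢ Set.univ) := by
    intro w hw
    simp only [avoiding, Set.mem_ofPred_eq, not_forall, not_not] at hw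
    obtain ⟨a, ha, hab⟩ := hw
    rw [Fin.sum_univ_succ] at hab
    simp only [Fin.cons_zero, Fin.cons_succ] at hab
    by_cases h0 : a 0 = 0
    · rw [h0, zero_smul, zero_add] at hab
      refine absurd hab (hv (fun j => a j.succ) fun h => ha ?_)
      ext j
      refine Fin.cases h0 (fun j => congrFun h j) j
    · refine ⟨((a 0)⁻¹ • (a 0 • w + ∑ j : Fin i, a j.succ • v j),
        fun j => (a 0)⁻¹ * a j.succ), ⟨hB _ _ (inv_ne_zero h0) hab, trivial⟩, ?_⟩
      simp only [smul_add, smul_smul, inv_mul_cancel₀ h0, one_smul, Finset.smul_sum]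
      abel
  refine (Set.ncard_le_ncard hsub).trans ((Set.ncard_image_le).trans ?_)
  rw [Set.ncard_prod, Set.ncard_univ, Nat.card_eq_fintype_card, Fintype.card_fun,
    Fintype.card_fin]

/-- Most families of vectors avoid a small set of points. -/
lemma pow_le_av_avoiding [Fintype F] [Finite E] {B : Set E}
    (hB : ∀ (a : F) (v : E), a ≠ 0 → v ∈ B → a • v ∈ B) {β : ℝ} (hβ : 0 ≤ β) (c : ℕ)
    (hcard : ∀ i < c, (B.ncard * Fintype.card F ^ i : ℝ) ≤ (1 - β) * Nat.card E) :
    β ^ c ≤ av (ind (avoiding F B c)) := by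
  induction c with
  | zero =>
    rw [pow_zero]
    refine le_av fun v => ?_
    rw [ind_of_mem]
    exact fun a ha => absurd (Subsingleton.elim a 0) ha
  | succ c ih =>
    specialize ih fun i hi => hcard i (by omega)
    have hslice : ∀ v : Fin c → E, β * ind (avoiding F B c) v ≤
        av (fun w => ind (avoiding F B (c + 1)) (Fin.cons w v)) := by
      intro v
      by_cases hv : v ∈ avoiding F B c
      · have hE : (0 : ℝ) < Nat.card E := by exact_mod_cast Nat.card_pos
        have h1 : (({w : E | (Fin.cons w v : Fin (c + 1) → E) ∉ avoiding F B (c + 1)}).ncard : ℝ) ≤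
            B.ncard * Fintype.card F ^ c := by
          exact_mod_cast ncard_cons_notMem_avoiding_le hB hv
        have h2 := hcard c (by omega)
        have h3 : av (ind {w : E | (Fin.cons w v : Fin (c + 1) → E) ∉ avoiding F B (c + 1)}) ≤
            1 - β := by
          rw [av_ind_eq_ncard_div, div_le_iff₀ hE]
          linarith
        have h4 : ∀ w : E, ind (avoiding F B (c + 1)) (Fin.cons w v) = 1 -
            ind {w : E | (Fin.cons w v : Fin (c + 1) → E) ∉ avoiding F B (c + 1)} w := by
          intro w
          by_cases hw : (Fin.cons w v : Fin (c + 1) → E) ∈ avoiding F B (c + 1)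
          · rw [ind_of_mem hw, ind_of_notMem (by simpa using hw), sub_zero]
          · rw [ind_of_notMem hw, ind_of_mem hw, sub_self]
        simp_rw [h4]
        rw [av_sub, av_const, ind_of_mem hv]
        linarith
      · rw [ind_of_notMem hv, mul_zero]
        exact av_nonneg fun w => ind_nonneg _ _
    have h5 : av (ind (avoiding F B (c + 1))) = av (fun v : Fin c → E =>
        av (fun w => ind (avoiding F B (c + 1)) (Fin.cons w v))) := by
      rw [← av_equiv (Fin.consEquiv fun _ => E), av_prod, av_comm]
      rfl
    rw [h5, pow_succ, mul_comm]
    refine le_trans ?_ (av_mono hslice)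
    rw [av_const_mul]
    gcongr

/-- The family of vectors with coefficients prescribed by a word. -/
def wordSum {ι : Type} [Fintype ι] {c d : ℕ} (b : Fin d × ι → E) (x : ι → Fin c → Fin d → F)
    (i : Fin c) : E :=
  ∑ e, ∑ k, x e i k • b (k, e)

/-- A dense set of families of `c` vectors contains all translates of some family by vectors of
some `d`-dimensional space. -/
lemma exists_translates_of_dense [Fintype F] (c d : ℕ) {δ : ℝ} (hδ : 0 < δ) :
    ∃ N : ℕ, ∀ (E : Type) [AddCommGroup E] [Module F E] [Finite E], N ≤ Module.finrank F E →
      ∀ T : Set (Fin c → E), δ ≤ av (ind T) →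
        ∃ (y : Fin c → E) (w : Fin d → E), LinearIndependent F w ∧
          ∀ X : Fin c → Fin d → F, (fun i => y i + ∑ k, X i k • w k) ∈ T := by
  classical
  obtain ⟨ι, _, hι⟩ := dhj (Fin c → Fin d → F) δ hδ
  have := Fintype.ofFinite ι
  refine ⟨Fintype.card (Fin d × ι), fun E _ _ _ hN T hT => ?_⟩
  have : FiniteDimensional F E := Module.Finite.of_finite
  obtain ⟨g⟩ : Nonempty ((Fin d × ι) ↪ Fin (Module.finrank F E)) :=
    Function.Embedding.nonempty_of_card_le (by rwa [Fintype.card_fin])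
  set b : Fin d × ι → E := Module.finBasis F E ∘ g with hb
  have hbi : LinearIndependent F b := (Module.finBasis F E).linearIndependent.comp g g.injective
  have h1 : δ ≤ av (fun y : Fin c → E => av (fun x : ι → Fin c → Fin d → F =>
      ind T (y + wordSum b x))) := by
    rw [av_comm]
    refine le_av fun x => ?_
    exact hT.trans (av_equiv (Equiv.addRight (wordSum b x)) (ind T)).ge
  obtain ⟨y, hy⟩ := exists_av_le fun y : Fin c → E => av (fun x : ι → Fin c → Fin d → F =>
      ind T (y + wordSum b x))
  obtain ⟨L, hL⟩ := hι {x | y + wordSum b x ∈ T}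
    ((h1.trans hy).trans (av_mono fun x => (ind_congr Iff.rfl).le))
  obtain ⟨e₀, he₀⟩ := L.proper ()
  set u : ι → F := fun e => (L.idxFun e).elim (fun _ => 0) fun _ => 1 with hu
  refine ⟨y + wordSum b (L 0), fun k => ∑ e, u e • b (k, e), ?_, fun X => ?_⟩
  · rw [Fintype.linearIndependent_iff] at hbi ⊢
    intro a ha k
    have h2 := hbi (fun p => a p.1 * u p.2) (by
      rw [Fintype.sum_prod_type, ← ha]
      simp_rw [Finset.smul_sum, smul_smul]) (k, e₀)
    simpa [hu, he₀] using h2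
  · have hX : y + wordSum b (L fun _ => X) ∈ T := hL fun _ => X
    convert hX using 1
    ext1 i
    rw [Pi.add_apply, Pi.add_apply, add_assoc]
    congr 1
    simp_rw [wordSum, Finset.smul_sum]
    rw [Finset.sum_comm (s := Finset.univ (α := Fin d)), ← Finset.sum_add_distrib]
    refine Finset.sum_congr rfl fun e _ => ?_
    rw [← Finset.sum_add_distrib]
    refine Finset.sum_congr rfl fun k _ => ?_
    rw [smul_smul, ← add_smul, Combinatorics.Subspace.apply_def, Combinatorics.Subspace.apply_def]
    cases h : L.idxFun e <;> simp [hu, h]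

lemma eq_zero_of_sum_mem {B : Set E} {c d : ℕ} {y : Fin c → E} {w : Fin d → E}
    (h : ∀ X : Fin c → Fin d → F, (fun i => y i + ∑ k, X i k • w k) ∈ avoiding F B c)
    {a : Fin c → F} {b : Fin d → F} (hab : ∑ i, a i • y i + ∑ k, b k • w k ∈ B) : a = 0 := by
  classical
  by_contra ha
  obtain ⟨j, hj⟩ := Function.ne_iff.1 ha
  refine h (fun i k => if i = j then (a j)⁻¹ * b k else 0) a ha ?_
  convert hab using 1
  simp_rw [smul_add]
  rw [Finset.sum_add_distrib, Finset.sum_eq_single j (f := fun i => a i • ∑ k, _ • w k)]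
  · congr 1
    rw [Finset.smul_sum]
    refine Finset.sum_congr rfl fun k _ => ?_
    rw [if_pos rfl, smul_smul, mul_inv_cancel_left₀ hj]
  · intro i _ hi
    simp [hi]
  · simp

/-- The cone over a set of points of a projective space. -/
def cone (G : Set (Projectivization F E)) : Set E :=
  {v | v = 0 ∨ ∃ h : v ≠ 0, Projectivization.mk F v h ∈ G}

lemma smul_mem_cone {G : Set (Projectivization F E)} (a : F) (v : E) (ha : a ≠ 0)
    (hv : v ∈ cone G) : a • v ∈ cone G := by
  rcases hv with rfl | ⟨h, hG⟩
  · exact Or.inl (smul_zero a)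
  · refine Or.inr ⟨smul_ne_zero ha h, ?_⟩
    convert hG using 1
    exact (Projectivization.mk_eq_mk_iff' F _ _ _ _).2 ⟨a, rfl⟩

lemma ncard_cone_le [Fintype F] [Finite E] (G : Set (Projectivization F E)) :
    (cone G).ncard ≤ G.ncard * (Fintype.card F - 1) + 1 := by
  classical
  have : Finite (Projectivization F E) := inferInstance
  have hsub : cone G ⊆ insert 0
      ((fun p : Projectivization F E × Fˣ => p.2 • p.1.rep) '' (G ×ˢ Set.univ)) := by
    rintro v (rfl | ⟨h, hG⟩)
    · exact Set.mem_insert _ _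
    · refine Set.mem_insert_of_mem _ ?_
      obtain ⟨a, ha⟩ := Projectivization.exists_smul_eq_mk_rep F v h
      exact ⟨(Projectivization.mk F v h, a⁻¹), ⟨hG, trivial⟩, by simp [← ha]⟩
  refine (Set.ncard_le_ncard hsub (Set.toFinite _)).trans ((Set.ncard_insert_le _ _).trans ?_)
  gcongr
  refine (Set.ncard_image_le (Set.toFinite _)).trans ?_
  rw [Set.ncard_prod, Set.ncard_univ, Nat.card_eq_fintype_card, Fintype.card_units]

end ErdosStoneGeometries

open ErdosStoneGeometries

/-- **Main Theorem.** For each prime power `q = |F|`, integers `m > c ≥ 0`, and real `ε > 0`,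
there is `R` such that for all `n > R`, every set `G` of points of `PG(n-1,q)` with
`|G| ≤ (1-ε)(q^(n-c+1)-1)/(q-1)` admits a rank-`m` flat `F` with `rank(F ∩ G) ≤ m - c`. -/
theorem erdos_stone_geometries_main (F : Type) [Field F] [Fintype F]
    (m c : ℕ) (hcm : c < m) (ε : ℝ) (hε : 0 < ε) :
    ∃ R : ℕ, ∀ n : ℕ, R < n →
      ∀ G : Set (Projectivization F (Fin n → F)),
        (G.ncard : ℝ) ≤ (1 - ε) *
            (((Fintype.card F : ℝ) ^ ((n : ℤ) - c + 1) - 1) / ((Fintype.card F : ℝ) - 1)) →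
        ∃ W : Submodule F (Fin n → F), Module.finrank F W = m ∧
          pgRank F n (pgFlat F n W ∩ G) ≤ m - c := by
  set q : ℝ := (Fintype.card F : ℝ) with hq
  have hq2 : 2 ≤ q := by
    have : 2 ≤ Fintype.card F := Fintype.one_lt_card
    rw [hq]
    exact_mod_cast this
  set β := min ε 1 / 2 with hβ
  have hβ0 : 0 < β := by positivity
  have hβε : 2 * β ≤ ε := by linarith [min_le_left ε 1]
  have hβ1 : 2 * β ≤ 1 := by linarith [min_le_right ε 1]
  obtain ⟨N, hN⟩ := exists_translates_of_dense (F := F) c (m - c) (pow_pos hβ0 c)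
  refine ⟨N + c, fun n hn G hG => ?_⟩
  have hB : ((cone G).ncard : ℝ) ≤ (1 - 2 * β) * q ^ (n - c + 1) + 2 * β := by
    have h1 : (n : ℤ) - c + 1 = ((n - c + 1 : ℕ) : ℤ) := by
      push_cast [Nat.cast_sub (show c ≤ n by omega)]
      ring
    rw [h1, zpow_natCast] at hG
    have h2 : ((cone G).ncard : ℝ) ≤ G.ncard * (q - 1) + 1 := by
      have := ncard_cone_le G
      have h3 : ((Fintype.card F - 1 : ℕ) : ℝ) = q - 1 := by
        rw [Nat.cast_sub Fintype.card_pos, Nat.cast_one]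
      rw [← h3]
      exact_mod_cast this
    have h4 : (G.ncard : ℝ) * (q - 1) ≤ (1 - ε) * (q ^ (n - c + 1) - 1) := by
      rw [← mul_div_assoc] at hG
      exact (le_div_iff₀ (by linarith)).1 hG
    have h5 : (1 - ε) * (q ^ (n - c + 1) - 1) ≤ (1 - 2 * β) * (q ^ (n - c + 1) - 1) := by
      have : 1 ≤ q ^ (n - c + 1) := one_le_pow₀ (by linarith)
      gcongr
    linarith
  have hcard : ∀ i < c, ((cone G).ncard * q ^ i : ℝ) ≤
      (1 - β) * Nat.card (Fin n → F) := by
    intro i hi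
    have h1 : (Nat.card (Fin n → F) : ℝ) = q ^ (n - c + 1) * q ^ (c - 1) := by
      rw [Nat.card_eq_fintype_card, Fintype.card_fun, Fintype.card_fin, ← pow_add]
      push_cast
      congr 1
      omega
    have h2 : q ^ i ≤ q ^ (c - 1) := pow_le_pow_right₀ (by linarith) (by omega)
    have h3 : 2 ≤ q ^ (n - c + 1) := hq2.trans (le_self_pow₀ (by linarith) (by omega))
    rw [h1, ← mul_assoc]
    have h4 : (1 - 2 * β) * q ^ (n - c + 1) + 2 * β ≤ (1 - β) * q ^ (n - c + 1) := by nlinarith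
    exact mul_le_mul (hB.trans h4) h2 (by positivity) (mul_nonneg (by linarith) (by positivity))
  obtain ⟨y, w, hw, hyw⟩ := hN (Fin n → F) (by simp; omega) (avoiding F (cone G) c)
    (pow_le_av_avoiding smul_mem_cone hβ0.le c hcard)
  have hind : LinearIndependent F (Sum.elim y w) := by
    rw [Fintype.linearIndependent_iff] at hw ⊢
    intro a ha
    rw [Fintype.sum_sum_type] at ha
    simp only [Sum.elim_inl, Sum.elim_inr] at ha
    have h0 := eq_zero_of_sum_mem (a := fun i => a (Sum.inl i)) (b := fun k => a (Sum.inr k)) hyw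
      (by rw [ha]; exact Or.inl rfl)
    have h1 : ∀ i, a (Sum.inl i) = 0 := fun i => congrFun h0 i
    simp only [h1, zero_smul, Finset.sum_const_zero, zero_add] at ha
    rintro (i | k)
    · exact h1 i
    · exact hw _ ha k
  refine ⟨Submodule.span F (Set.range (Sum.elim y w)), ?_, ?_⟩
  · rw [finrank_span_eq_card hind, Fintype.card_sum, Fintype.card_fin, Fintype.card_fin]
    omega
  · refine le_trans (Submodule.finrank_mono (t := Submodule.span F (Set.range w)) ?_)
      ((finrank_range_le_card w).trans (Fintype.card_fin _).le)
    refine iSup₂_le fun x hx => ?_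
    rw [Projectivization.submodule_eq, Submodule.span_singleton_le_iff_mem]
    have h1 : x.rep ∈ Submodule.span F (Set.range (Sum.elim y w)) := by
      have := hx.1
      rwa [pgFlat, Set.mem_ofPred_eq, Projectivization.submodule_eq,
        Submodule.span_singleton_le_iff_mem] at this
    obtain ⟨a, ha⟩ := (Submodule.mem_span_range_iff_exists_fun F).1 h1
    rw [Fintype.sum_sum_type] at ha
    simp only [Sum.elim_inl, Sum.elim_inr] at ha
    have h0 := eq_zero_of_sum_mem (a := fun i => a (Sum.inl i)) (b := fun k => a (Sum.inr k)) hyw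
      (by rw [ha]; exact Or.inr ⟨x.rep_nonzero, by rw [x.mk_rep]; exact hx.2⟩)
    have h2 : ∀ i, a (Sum.inl i) = 0 := fun i => congrFun h0 i
    simp only [h2, zero_smul, Finset.sum_const_zero, zero_add] at ha
    exact (Submodule.mem_span_range_iff_exists_fun F).2 ⟨_, ha⟩
end

section
/- For each prime power q, all integers m > c ≥ 1, and any real number ε > 0, there is an integer R (depending on m, q, c, ε) such that for all n > R: ex_q(G(m-1,q,c); n) < (1 - q^{1-c} + ε)·(q^n-1)/(q-1). -/
open Combinatorics

/-! ### Averages over finite types -/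

/-- The average of a real function on a finite type. -/
noncomputable def avg {X : Type*} [Finite X] (f : X → ℝ) : ℝ :=
  letI := Fintype.ofFinite X
  Finset.expect Finset.univ f

/-- The real number `1` if `p` holds and `0` otherwise. -/
noncomputable def ind (p : Prop) : ℝ := by
  classical exact if p then 1 else 0

section Averages

variable {X Y : Type*}

lemma ind_true {p : Prop} (h : p) : ind p = 1 := by simp [ind, h]

lemma ind_false {p : Prop} (h : ¬p) : ind p = 0 := by simp [ind, h]

lemma ind_nonneg (p : Prop) : 0 ≤ ind p := by
  by_cases h : p <;> simp [ind, h]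

lemma ind_le_one (p : Prop) : ind p ≤ 1 := by
  by_cases h : p <;> simp [ind, h]

lemma ind_not (p : Prop) : ind (¬p) = 1 - ind p := by
  by_cases h : p <;> simp [ind, h]

variable [Finite X] [Finite Y]

lemma avg_mono {f g : X → ℝ} (h : ∀ x, f x ≤ g x) : avg f ≤ avg g := by
  let := Fintype.ofFinite X
  exact Finset.expect_le_expect fun x _ => h x

lemma avg_congr {f g : X → ℝ} (h : ∀ x, f x = g x) : avg f = avg g := by
  rw [funext h]

lemma avg_add (f g : X → ℝ) : avg (fun x => f x + g x) = avg f + avg g :=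
  Finset.expect_add_distrib _ _ _

lemma avg_sub (f g : X → ℝ) : avg (fun x => f x - g x) = avg f - avg g :=
  Finset.expect_sub_distrib _ _ _

lemma avg_const_mul (c : ℝ) (f : X → ℝ) : avg (fun x => c * f x) = c * avg f :=
  (Finset.mul_expect _ _ _).symm

lemma avg_const [Nonempty X] (c : ℝ) : avg (fun _ : X => c) = c :=
  let := Fintype.ofFinite X
  Finset.expect_const Finset.univ_nonempty _

lemma avg_nonneg {f : X → ℝ} (h : ∀ x, 0 ≤ f x) : 0 ≤ avg f :=
  let := Fintype.ofFinite X
  Finset.expect_nonneg fun x _ => h x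

lemma avg_le_const [Nonempty X] {f : X → ℝ} {c : ℝ} (h : ∀ x, f x ≤ c) : avg f ≤ c :=
  (avg_mono h).trans_eq (avg_const c)

lemma const_le_avg [Nonempty X] {f : X → ℝ} {c : ℝ} (h : ∀ x, c ≤ f x) : c ≤ avg f :=
  (avg_const c).symm.trans_le (avg_mono h)

lemma exists_le_of_le_avg [Nonempty X] {f : X → ℝ} {c : ℝ} (h : c ≤ avg f) :
    ∃ x, c ≤ f x := by
  obtain ⟨x, hx⟩ := Finite.exists_max f
  exact ⟨x, h.trans (avg_le_const hx)⟩

lemma avg_sum {S : Type*} (s : Finset S) (f : S → X → ℝ) :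
    avg (fun x => ∑ i ∈ s, f i x) = ∑ i ∈ s, avg (f i) :=
  Finset.expect_sum_comm _ _ _

lemma avg_comm (f : X → Y → ℝ) :
    avg (fun x => avg fun y => f x y) = avg (fun y => avg fun x => f x y) :=
  Finset.expect_comm _ _ _

lemma avg_equiv (e : X ≃ Y) (f : Y → ℝ) : avg (fun x => f (e x)) = avg f :=
  let := Fintype.ofFinite X
  let := Fintype.ofFinite Y
  Fintype.expect_equiv e _ _ fun _ => rfl

lemma avg_prod (f : X × Y → ℝ) : avg f = avg fun x => avg fun y => f (x, y) := by
  let := Fintype.ofFinite X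
  let := Fintype.ofFinite Y
  have := Finset.expect_product (Finset.univ : Finset X) (Finset.univ : Finset Y) f
  unfold avg
  rw [← this]
  congr 1
  ext; simp

lemma avg_eq_sum [Fintype X] (f : X → ℝ) : avg f = (∑ x, f x) / Fintype.card X := by
  rw [avg, Subsingleton.elim (Fintype.ofFinite X) ‹_›, Fintype.expect_eq_sum_div_card]

/-- The average of a function supported on the range of an injective map. -/
lemma avg_range (j : X → Y) (hj : Function.Injective j) (f : Y → ℝ) :
    avg (fun y => ind (y ∈ Set.range j) * f y) =
      (Nat.card X / Nat.card Y : ℝ) * avg (fun x => f (j x)) := by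
  classical
  let := Fintype.ofFinite X
  let := Fintype.ofFinite Y
  have h : ∑ y, ind (y ∈ Set.range j) * f y = ∑ x, f (j x) := by
    rw [← Finset.sum_image (s := Finset.univ) (g := j) (f := f) (fun a _ b _ h => hj h)]
    symm
    refine Finset.sum_subset_zero_on_sdiff (Finset.subset_univ _) ?_ ?_
    · intro y hy
      rw [ind_false (by simpa using hy), zero_mul]
    · intro y hy
      rw [ind_true (by simpa using hy), one_mul]
  rw [avg_eq_sum, avg_eq_sum, h, Nat.card_eq_fintype_card, Nat.card_eq_fintype_card]
  rcases isEmpty_or_nonempty X with hX | hX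
  · simp
  · have : (Fintype.card X : ℝ) ≠ 0 := by simp
    field_simp

lemma avg_range_one (j : X → Y) (hj : Function.Injective j) [Nonempty X] :
    avg (fun y => ind (y ∈ Set.range j)) = (Nat.card X / Nat.card Y : ℝ) := by
  simpa [avg_const] using avg_range j hj fun _ => 1

/-- Markov's inequality for a function `f ≤ 1`. -/
lemma sub_le_avg_ind [Nonempty X] {f : X → ℝ} (h1 : ∀ x, f x ≤ 1) (c : ℝ) (hc : 0 ≤ c) :
    avg f - c ≤ avg fun x => ind (c ≤ f x) := by
  rw [sub_le_iff_le_add, ← avg_const (X := X) c, ← avg_add]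
  refine avg_mono fun x => ?_
  rw [avg_const]
  by_cases h : c ≤ f x
  · rw [ind_true h]
    linarith [h1 x]
  · rw [ind_false h]
    linarith

lemma avg_sumElim {ι κ α : Type*} [Finite ι] [Finite κ] [Finite α] (f : (ι ⊕ κ → α) → ℝ) :
    avg f = avg fun u : ι → α => avg fun w : κ → α => f (Sum.elim u w) := by
  rw [← avg_equiv (Equiv.sumArrowEquivProdArrow ι κ α).symm f, avg_prod]
  rfl

end Averages

/-! ### Operations on combinatorial subspaces -/

section Subspaces

variable {α η θ ι κ : Type*}

/-- Replace every blank letter of a word by `a`. -/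
def fillNone (a : α) (y : ι → Option α) : ι → α := fun i => (y i).getD a

lemma fillNone_sumElim (a : α) (y : ι → Option α) (z : κ → Option α) :
    fillNone a (Sum.elim y z) = Sum.elim (fillNone a y) (fillNone a z) := by
  ext (i | i) <;> rfl

namespace Combinatorics.Subspace

/-- Composition of combinatorial subspaces. -/
def comp (l : Subspace η α ι) (l' : Subspace θ α η) : Subspace θ α ι where
  idxFun i := (l.idxFun i).elim Sum.inl l'.idxFun
  proper e := by
    obtain ⟨j, hj⟩ := l'.proper e
    obtain ⟨i, hi⟩ := l.proper j
    exact ⟨i, by simp [hi, hj]⟩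

lemma comp_apply (l : Subspace η α ι) (l' : Subspace θ α η) (x : θ → α) :
    l.comp l' x = l (l' x) := by
  ext i
  cases h : l.idxFun i <;> simp [comp, coe_apply, h]

/-- Regard a subspace over `α` as a subspace over `Option α`. -/
def extend (l : Subspace η α ι) : Subspace η (Option α) ι where
  idxFun i := (l.idxFun i).map some id
  proper e := by
    obtain ⟨i, hi⟩ := l.proper e
    exact ⟨i, by simp [hi]⟩

/-- Replace the blank letters in a subspace by `a`. -/
def fill (a : α) (l : Subspace η (Option α) ι) : Subspace η α ι where
  idxFun i := (l.idxFun i).map (fun b => b.getD a) id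
  proper e := by
    obtain ⟨i, hi⟩ := l.proper e
    exact ⟨i, by simp [hi]⟩

lemma fillNone_apply (a : α) (l : Subspace η (Option α) ι) (y : η → Option α) :
    fillNone a (l y) = l.fill a (fillNone a y) := by
  ext i
  cases h : l.idxFun i <;> simp [fill, fillNone, coe_apply, h]

lemma fillNone_extend (a : α) (l : Subspace η α ι) (y : η → Option α) :
    fillNone a (l.extend y) = l (fillNone a y) := by
  ext i
  cases h : l.idxFun i <;> simp [extend, fillNone, coe_apply, h]

/-- The subspace of `ι ⊕ κ → α` whose second component is the fixed word `w`. -/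
def horizontal (l : Subspace η α ι) (w : κ → α) : Subspace η α (ι ⊕ κ) where
  idxFun := Sum.elim l.idxFun fun k => Sum.inl (w k)
  proper e := by
    obtain ⟨i, hi⟩ := l.proper e
    exact ⟨Sum.inl i, by simp [hi]⟩

lemma horizontal_apply (l : Subspace η α ι) (w : κ → α) (x : η → α) :
    l.horizontal w x = Sum.elim (l x) w := by
  ext (i | i) <;> simp [horizontal, coe_apply]

/-- The subspace of `ι ⊕ κ → α` whose first component is the fixed word `u`. -/
def vertical (u : ι → α) (l : Subspace η α κ) : Subspace η α (ι ⊕ κ) where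
  idxFun := Sum.elim (fun i => Sum.inl (u i)) l.idxFun
  proper e := by
    obtain ⟨i, hi⟩ := l.proper e
    exact ⟨Sum.inr i, by simp [hi]⟩

lemma vertical_apply (u : ι → α) (l : Subspace η α κ) (x : η → α) :
    l.vertical u x = Sum.elim u (l x) := by
  ext (i | i) <;> simp [vertical, coe_apply]

/-- The product of a line and a subspace. -/
def lineProd (l : Subspace Unit α ι) (l' : Subspace η α κ) :
    Subspace (Option η) α (ι ⊕ κ) where
  idxFun := Sum.elim (fun i => (l.idxFun i).map id fun _ => none)
    fun k => (l'.idxFun k).map id some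
  proper e := by
    cases e with
    | none =>
      obtain ⟨i, hi⟩ := l.proper ()
      exact ⟨Sum.inl i, by simp [hi]⟩
    | some e =>
      obtain ⟨i, hi⟩ := l'.proper e
      exact ⟨Sum.inr i, by simp [hi]⟩

lemma lineProd_apply (l : Subspace Unit α ι) (l' : Subspace η α κ) (x : Option η → α) :
    l.lineProd l' x = Sum.elim (l fun _ => x none) (l' fun e => x (some e)) := by
  ext (i | i)
  · cases h : l.idxFun i <;> simp [lineProd, coe_apply, h]
  · cases h : l'.idxFun i <;> simp [lineProd, coe_apply, h]

lemma injective_apply (l : Subspace η α ι) : Function.Injective (fun x : η → α => l x) := by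
  intro x y h
  ext e
  obtain ⟨i, hi⟩ := l.proper e
  simpa [apply_inr hi] using congrFun h i

end Combinatorics.Subspace

end Subspaces

/-! ### Density Hales–Jewett: statements and the multidimensional version -/

/-- Every sufficiently high-dimensional set of words over `α` of positive density contains a
combinatorial subspace with set of variables `η`. -/
def DenseSubspace (α η : Type) [Finite α] : Prop :=
  ∀ δ : ℝ, 0 < δ → ∃ (ι : Type) (_ : Finite ι), ∀ A : Set (ι → α),
    δ ≤ avg (fun x => ind (x ∈ A)) → ∃ l : Subspace η α ι, ∀ x, l x ∈ A

lemma DenseSubspace.of_isEmpty (α : Type) [Finite α] (η : Type) [IsEmpty η] :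
    DenseSubspace α η := by
  intro δ hδ
  refine ⟨Empty, inferInstance, fun A hA => ?_⟩
  refine ⟨⟨Empty.elim, fun e => isEmptyElim e⟩, fun x => ?_⟩
  obtain ⟨y, hy⟩ := exists_le_of_le_avg hA
  rw [Subsingleton.elim (Subspace.toFun _ x) y]
  by_contra h
  rw [ind_false h] at hy
  linarith

lemma DenseSubspace.option {α η : Type} [Finite α] [Nonempty α] [Finite η]
    (h1 : DenseSubspace α Unit) (h : DenseSubspace α η) : DenseSubspace α (Option η) := by
  classical
  intro δ hδ
  obtain ⟨ι, _, hι⟩ := h1 (δ / 2) (by positivity)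
  let T := Subspace Unit α ι
  have : Finite T := Finite.of_injective (fun l : T => l.idxFun) fun l l' h => Subspace.ext h
  let := Fintype.ofFinite T
  obtain ⟨κ, _, hκ⟩ := h (δ / 2 / (Fintype.card T + 1)) (by positivity)
  refine ⟨ι ⊕ κ, inferInstance, fun A hA => ?_⟩
  rw [avg_sumElim, avg_comm] at hA
  have h2 := sub_le_avg_ind (f := fun w : κ → α => avg fun u : ι → α => ind (Sum.elim u w ∈ A))
    (fun w => avg_le_const fun u => ind_le_one _) (δ / 2) (by positivity)
  by_contra hcon
  have key : ∀ l : T, avg (fun w : κ → α => ind (∀ x, Sum.elim (l x) w ∈ A)) ≤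
      δ / 2 / (Fintype.card T + 1) := by
    intro l
    by_contra! hl
    obtain ⟨l', hl'⟩ := hκ {w | ∀ x, Sum.elim (l x) w ∈ A} hl.le
    refine hcon ⟨l.lineProd l', fun x => ?_⟩
    rw [Subspace.lineProd_apply]
    exact hl' _ _
  have h3 : avg (fun w : κ → α => ind (δ / 2 ≤ avg fun u : ι → α => ind (Sum.elim u w ∈ A))) ≤
      ∑ l : T, avg (fun w : κ → α => ind (∀ x, Sum.elim (l x) w ∈ A)) := by
    rw [← avg_sum]
    refine avg_mono fun w => ?_
    by_cases hw : δ / 2 ≤ avg fun u : ι → α => ind (Sum.elim u w ∈ A)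
    · obtain ⟨l, hl⟩ := hι {u | Sum.elim u w ∈ A} hw
      rw [ind_true hw, ← ind_true hl]
      exact Finset.single_le_sum (f := fun l : T => ind (∀ x, Sum.elim (l x) w ∈ A))
        (fun _ _ => ind_nonneg _) (Finset.mem_univ l)
    · rw [ind_false hw]
      exact Finset.sum_nonneg fun _ _ => ind_nonneg _
  have h4 := Finset.sum_le_sum fun l (_ : l ∈ (Finset.univ : Finset T)) => key l
  rw [Finset.sum_const, Finset.card_univ, nsmul_eq_mul] at h4
  have h5 : (Fintype.card T : ℝ) * (δ / 2 / (Fintype.card T + 1)) < δ / 2 := by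
    rw [mul_div_assoc', div_lt_iff₀ (by positivity)]
    nlinarith
  linarith

lemma DenseSubspace.of_equiv {α η η' : Type} [Finite α] (e : η ≃ η')
    (h : DenseSubspace α η) : DenseSubspace α η' := by
  intro δ hδ
  obtain ⟨ι, hf, hι⟩ := h δ hδ
  refine ⟨ι, hf, fun A hA => ?_⟩
  obtain ⟨l, hl⟩ := hι A hA
  refine ⟨l.reindex e (Equiv.refl _) (Equiv.refl _), fun x => ?_⟩
  convert! hl (x ∘ e)
  ext i
  simp

/-- The density Hales–Jewett theorem for lines implies the multidimensional version. -/
lemma DenseSubspace.of_line {α : Type} [Finite α] [Nonempty α] (h1 : DenseSubspace α Unit)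
    (η : Type) [Finite η] : DenseSubspace α η := by
  induction η using Finite.induction_empty_option with
  | of_equiv e h => exact h.of_equiv e
  | h_empty => exact .of_isEmpty α _
  | h_option h => exact h1.option h

/-! ### Sets that ignore the difference between two letters -/

/-- A set of words over `Option α` which does not distinguish the blank letter from `a`, of
density bounded below, contains a subspace. -/
lemma DenseSubspace.exists_fillNone {α η : Type} [Finite α] [Nonempty α] [Finite η]
    (h : DenseSubspace α η) (a : α) (δ : ℝ) (hδ : 0 < δ) :
    ∃ (ι : Type) (_ : Finite ι), ∀ E : Set (ι → α),
      δ ≤ avg (fun y : ι → Option α => ind (fillNone a y ∈ E)) →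
        ∃ l : Subspace η α ι, ∀ x, l x ∈ E := by
  obtain ⟨κ, _, hκ⟩ := h (δ / 2) (by positivity)
  set p : ℝ := Nat.card (κ → α) / Nat.card (κ → Option α) with hp
  let j : (κ → α) → κ → Option α := fun x i => some (x i)
  have hj : Function.Injective j := fun x y h => by
    ext i
    exact Option.some_injective _ (congrFun h i)
  have hp0 : 0 < p := by
    rw [hp]
    have : 0 < Nat.card (κ → α) := Nat.card_pos
    have : 0 < Nat.card (κ → Option α) := Nat.card_pos
    positivity
  have hp1 : p ≤ 1 := by
    rw [hp, ← avg_range_one j hj]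
    exact avg_le_const fun _ => ind_le_one _
  have claim : ∀ t : ℕ, ∃ (ι : Type) (_ : Finite ι), ∀ E : Set (ι → α),
      (¬∃ l : Subspace η α ι, ∀ x, l x ∈ E) →
      avg (fun y : ι → Option α => ind (fillNone a y ∈ E)) ≤ δ / 2 + (1 - p) ^ t := by
    intro t
    induction t with
    | zero =>
      refine ⟨Empty, inferInstance, fun E _ => ?_⟩
      refine avg_le_const fun y => (ind_le_one _).trans ?_
      simp only [pow_zero]
      linarith
    | succ t ih =>
      obtain ⟨ι, _, hι⟩ := ih
      refine ⟨κ ⊕ ι, inferInstance, fun E hE => ?_⟩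
      rw [avg_sumElim]
      simp only [fillNone_sumElim]
      set f : (κ → Option α) → ℝ := fun u => avg fun w : ι → Option α =>
        ind (Sum.elim (fillNone a u) (fillNone a w) ∈ E) with hf
      set B : ℝ := δ / 2 + (1 - p) ^ t with hB
      have hfB : ∀ u, f u ≤ B := by
        intro u
        refine hι {w | Sum.elim (fillNone a u) w ∈ E} ?_
        rintro ⟨l, hl⟩
        refine hE ⟨l.vertical (fillNone a u), fun x => ?_⟩
        rw [Subspace.vertical_apply]
        exact hl x
      have hfj : avg (fun x => f (j x)) ≤ δ / 2 := by
        rw [hf, avg_comm]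
        refine avg_le_const fun w => ?_
        by_contra! hw
        obtain ⟨l, hl⟩ := hκ {u | Sum.elim u (fillNone a w) ∈ E} hw.le
        refine hE ⟨l.horizontal (fillNone a w), fun x => ?_⟩
        rw [Subspace.horizontal_apply]
        exact hl x
      have h1 : avg f ≤ avg (fun u => ind (u ∈ Set.range j) * f u +
          (B - B * ind (u ∈ Set.range j))) := by
        refine avg_mono fun u => ?_
        by_cases hu : u ∈ Set.range j
        · rw [ind_true hu]
          linarith
        · rw [ind_false hu]
          linarith [hfB u]
      rw [avg_add, avg_sub, avg_const_mul, avg_const, avg_range j hj, avg_range_one j hj,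
        ← hp] at h1
      have h2 := mul_le_mul_of_nonneg_left hfj hp0.le
      calc avg f ≤ p * (δ / 2) + (B - B * p) := by linarith
        _ = δ / 2 + (1 - p) ^ (t + 1) := by rw [hB]; ring
  obtain ⟨t, ht⟩ := exists_pow_lt_of_lt_one (show 0 < δ / 2 by positivity)
    (show 1 - p < 1 by linarith)
  obtain ⟨ι, hfin, hι⟩ := claim t
  refine ⟨ι, hfin, fun E hE => ?_⟩
  by_contra hcon
  linarith [hι E hcon]

/-- If `E` does not distinguish the blank letter from `a`, and the average of `g` is small on
every subspace contained in `E`, then the average of `g` on `E` is small. -/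
lemma DenseSubspace.avg_fillNone_le {α η : Type} [Finite α] [Nonempty α] [Finite η]
    (h : DenseSubspace α η) (a : α) (c : ℝ) (hc : 0 < c) (hc1 : c ≤ 1) :
    ∃ (ι : Type) (_ : Finite ι), ∀ (E : Set (ι → α)) (g : (ι → Option α) → ℝ),
      (∀ y, g y ≤ 1) →
      (∀ l : Subspace η (Option α) ι, (∀ x, fillNone a (l x) ∈ E) →
        avg (fun x => g (l x)) ≤ c) →
      avg (fun y => ind (fillNone a y ∈ E) * g y) ≤ 3 * c := by
  obtain ⟨κ, _, hκ⟩ := h.exists_fillNone a (c / 2) (by positivity)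
  set q : ℝ := Nat.card (η → Option α) / Nat.card (κ → Option α) with hq
  set ρ : ℝ := c / 2 / Nat.card (κ → Option α) with hρ
  have hκ1 : (1 : ℝ) ≤ Nat.card (κ → Option α) := by exact_mod_cast Nat.card_pos
  have hη1 : (1 : ℝ) ≤ Nat.card (η → Option α) := by exact_mod_cast Nat.card_pos
  have hρ0 : 0 < ρ := by positivity
  have hq0 : 0 ≤ q := by positivity
  have hρ1 : ρ ≤ 1 := by
    rw [hρ, div_le_one (by linarith)]
    linarith
  have hρq : ρ ≤ c / 2 * q := by
    rw [hρ, hq, mul_div_assoc']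
    gcongr
    nlinarith
  obtain ⟨l₀, -⟩ := hκ Set.univ (by
    simp only [Set.mem_univ, ind_true, avg_const]
    linarith)
  have claim : ∀ t : ℕ, ∃ (ι : Type) (_ : Finite ι), ∀ (E : Set (ι → α))
      (g : (ι → Option α) → ℝ), (∀ y, g y ≤ 1) →
      (∀ l : Subspace η (Option α) ι, (∀ x, fillNone a (l x) ∈ E) →
        avg (fun x => g (l x)) ≤ c) →
      avg (fun y => ind (fillNone a y ∈ E) * g y) ≤
        c * avg (fun y : ι → Option α => ind (fillNone a y ∈ E)) + c +
          (1 - ρ) ^ t * avg (fun y : ι → Option α => ind (fillNone a y ∈ E)) := by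
    intro t
    induction t with
    | zero =>
      refine ⟨Empty, inferInstance, fun E g hg _ => ?_⟩
      have h1 : avg (fun y : Empty → Option α => ind (fillNone a y ∈ E) * g y) ≤
          avg (fun y : Empty → Option α => ind (fillNone a y ∈ E)) :=
        avg_mono fun y => mul_le_of_le_one_right (ind_nonneg _) (hg y)
      have h2 : 0 ≤ avg (fun y : Empty → Option α => ind (fillNone a y ∈ E)) :=
        avg_nonneg fun y => ind_nonneg _
      rw [pow_zero, one_mul]
      nlinarith
    | succ t ih =>
      obtain ⟨ι, _, hι⟩ := ih
      refine ⟨κ ⊕ ι, inferInstance, fun E g hg hE => ?_⟩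
      set D := avg (fun y : κ ⊕ ι → Option α => ind (fillNone a y ∈ E)) with hD
      have hD0 : 0 ≤ D := avg_nonneg fun y => ind_nonneg _
      have hD1 : D ≤ 1 := avg_le_const fun y => ind_le_one _
      have hpow : ∀ n : ℕ, 0 ≤ (1 - ρ) ^ n := fun n => pow_nonneg (by linarith) n
      rcases le_or_gt D c with hDc | hDc
      · have h1 : avg (fun y => ind (fillNone a y ∈ E) * g y) ≤ D :=
          avg_mono fun y => mul_le_of_le_one_right (ind_nonneg _) (hg y)
        have h2 := mul_nonneg (hpow (t + 1)) hD0
        have h3 := mul_nonneg hc.le hD0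
        linarith
      let s : (ι → α) → ℝ := fun z => avg fun y : κ → Option α =>
        ind (Sum.elim (fillNone a y) z ∈ E)
      have hV : ∀ z, ∃ l : Subspace η (Option α) κ, c / 2 ≤ s z →
          ∀ x, Sum.elim (fillNone a (l x)) z ∈ E := by
        intro z
        by_cases hz : c / 2 ≤ s z
        · obtain ⟨l, hl⟩ := hκ {y | Sum.elim y z ∈ E} hz
          refine ⟨l.extend, fun _ x => ?_⟩
          rw [Subspace.fillNone_extend]
          exact hl _
        · exact ⟨l₀.extend, fun h => absurd h hz⟩
      choose V hV using hV
      let r : (κ → Option α) → (ι → α) → Prop := fun y z =>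
        c / 2 ≤ s z ∧ y ∈ Set.range fun x => V z x
      let E' : (κ → Option α) → Set (ι → α) := fun y =>
        {z | Sum.elim (fillNone a y) z ∈ E ∧ ¬r y z}
      have hsplit : ∀ (y : κ → Option α) (z : ι → Option α),
          ind (fillNone a (Sum.elim y z) ∈ E) =
            ind (r y (fillNone a z)) + ind (fillNone a z ∈ E' y) := by
        intro y z
        rw [fillNone_sumElim]
        by_cases hr : r y (fillNone a z)
        · obtain ⟨hz, x, rfl⟩ := hr
          rw [ind_true (hV _ hz x), ind_true ⟨hz, x, rfl⟩, ind_false, add_zero]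
          exact fun h => h.2 ⟨hz, x, rfl⟩
        · rw [ind_false hr, zero_add]
          simp [E', hr]
      set P := avg fun y : κ → Option α => avg fun z : ι → Option α =>
        ind (r y (fillNone a z)) with hP
      set D' := avg fun y : κ → Option α => avg fun z : ι → Option α =>
        ind (fillNone a z ∈ E' y) with hD'
      have hDP : D = P + D' := by
        rw [hD, avg_sumElim]
        simp only [hsplit, avg_add]
        rw [hP, hD']
      have hrange : ∀ z : ι → Option α, c / 2 ≤ s (fillNone a z) →
          ∀ y, ind (r y (fillNone a z)) = ind (y ∈ Set.range fun x => V (fillNone a z) x) := by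
        intro z hz y
        simp [r, hz]
      have hempty : ∀ z : ι → Option α, ¬c / 2 ≤ s (fillNone a z) →
          ∀ y, ind (r y (fillNone a z)) = 0 := by
        intro z hz y
        exact ind_false fun h => hz h.1
      have hPq : c / 2 * q ≤ P := by
        have h1 := sub_le_avg_ind (f := fun z : ι → Option α => s (fillNone a z))
          (fun z => avg_le_const fun _ => ind_le_one _) (c / 2) (by positivity)
        have h2 : avg (fun z : ι → Option α => s (fillNone a z)) = D := by
          rw [hD, avg_sumElim, avg_comm]
          simp only [fillNone_sumElim]
        have h3 : P = q * avg fun z : ι → Option α => ind (c / 2 ≤ s (fillNone a z)) := by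
          rw [hP, avg_comm, ← avg_const_mul]
          refine avg_congr fun z => ?_
          by_cases hz : c / 2 ≤ s (fillNone a z)
          · rw [ind_true hz, avg_congr (hrange z hz),
              avg_range_one _ (Subspace.injective_apply _), mul_one]
          · rw [ind_false hz, avg_congr (hempty z hz), avg_const, mul_zero]
        rw [h3, mul_comm]
        refine mul_le_mul_of_nonneg_left ?_ hq0
        linarith
      have hR : (avg fun y : κ → Option α => avg fun z : ι → Option α =>
          ind (r y (fillNone a z)) * g (Sum.elim y z)) ≤ c * P := by
        rw [hP, avg_comm, avg_comm (fun (y : κ → Option α) (z : ι → Option α) =>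
          ind (r y (fillNone a z))), ← avg_const_mul]
        refine avg_mono fun z => ?_
        by_cases hz : c / 2 ≤ s (fillNone a z)
        · simp only [hrange z hz]
          rw [avg_range _ (Subspace.injective_apply _) fun y => g (Sum.elim y z),
            avg_range_one _ (Subspace.injective_apply _), mul_comm c]
          refine mul_le_mul_of_nonneg_left ?_ hq0
          have := hE ((V (fillNone a z)).horizontal z) fun x => by
            rw [Subspace.horizontal_apply, fillNone_sumElim]
            exact hV _ hz x
          simpa only [Subspace.horizontal_apply] using this
        · simp only [hempty z hz, zero_mul, avg_const, mul_zero, le_refl]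
      have hrest : (avg fun y : κ → Option α => avg fun z : ι → Option α =>
          ind (fillNone a z ∈ E' y) * g (Sum.elim y z)) ≤ c * D' + c + (1 - ρ) ^ t * D' := by
        refine (avg_mono (g := fun y => c * avg (fun z : ι → Option α =>
          ind (fillNone a z ∈ E' y)) + c + (1 - ρ) ^ t * avg fun z : ι → Option α =>
            ind (fillNone a z ∈ E' y)) fun y => ?_).trans_eq (by
          rw [avg_add, avg_add, avg_const_mul, avg_const_mul, avg_const])
        refine hι (E' y) (fun z => g (Sum.elim y z)) (fun z => hg _) fun l hl => ?_
        have := hE (l.vertical y) fun x => by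
          rw [Subspace.vertical_apply, fillNone_sumElim]
          exact (hl x).1
        simpa only [Subspace.vertical_apply] using this
      have hsum : avg (fun y => ind (fillNone a y ∈ E) * g y) ≤
          c * P + (c * D' + c + (1 - ρ) ^ t * D') := by
        rw [avg_sumElim]
        simp only [hsplit, add_mul, avg_add]
        exact add_le_add hR hrest
      have h1 : D' ≤ (1 - ρ) * D := by nlinarith
      have h2 := mul_le_mul_of_nonneg_left h1 (hpow t)
      calc _ ≤ c * P + (c * D' + c + (1 - ρ) ^ t * D') := hsum
        _ ≤ c * D + c + (1 - ρ) ^ t * ((1 - ρ) * D) := by rw [hDP] at h2 ⊢; linarith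
        _ = _ := by ring
  obtain ⟨t, ht⟩ := exists_pow_lt_of_lt_one hc (show 1 - ρ < 1 by linarith)
  obtain ⟨ι, hfin, hι⟩ := claim t
  refine ⟨ι, hfin, fun E g hg hE => (hι E g hg hE).trans ?_⟩
  have h0 : 0 ≤ avg (fun y : ι → Option α => ind (fillNone a y ∈ E)) :=
    avg_nonneg fun y => ind_nonneg _
  have h1 : avg (fun y : ι → Option α => ind (fillNone a y ∈ E)) ≤ 1 :=
    avg_le_const fun y => ind_le_one _
  nlinarith

/-- The version of `DenseSubspace.avg_fillNone_le` for intersections of sets each of which does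
not distinguish the blank letter from some other letter. -/
lemma DenseSubspace.avg_forall_fillNone_le {α : Type} [Finite α] [Nonempty α]
    (h : DenseSubspace α Unit) (η : Type) [Finite η] (s : Finset α) (c : ℝ) (hc : 0 < c) :
    ∃ (ι : Type) (_ : Finite ι), ∀ (E : α → Set (ι → α)) (g : (ι → Option α) → ℝ),
      (∀ y, g y ≤ 1) → (∀ l : Subspace η (Option α) ι, avg (fun x => g (l x)) ≤ 0) →
      avg (fun y => ind (∀ a ∈ s, fillNone a y ∈ E a) * g y) ≤ c := by
  classical
  induction s using Finset.induction_on generalizing c with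
  | empty =>
    refine ⟨η, inferInstance, fun E g _ hE => ?_⟩
    have := hE default
    refine le_trans (le_of_eq (avg_congr fun y => ?_)) (this.trans hc.le)
    rw [ind_true (by simp), one_mul]
    rfl
  | insert b s hb ih =>
    obtain ⟨η', _, hη'⟩ := ih (min (c / 3) 1) (by positivity)
    obtain ⟨ι, hfin, hι⟩ := (h.of_line η').avg_fillNone_le b (min (c / 3) 1) (by positivity)
      (min_le_right _ _)
    refine ⟨ι, hfin, fun E g hg hE => ?_⟩
    have := hι (E b) (fun y => ind (∀ a ∈ s, fillNone a y ∈ E a) * g y) (fun y => ?_)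
      fun l _ => ?_
    · refine le_trans (le_of_eq (avg_congr fun y => ?_)) (this.trans ?_)
      · rw [← mul_assoc]
        congr 1
        by_cases h1 : fillNone b y ∈ E b <;> simp [ind, h1]
      · linarith [min_le_left (c / 3) 1]
    · by_cases h1 : ∀ a ∈ s, fillNone a y ∈ E a
      · rw [ind_true h1, one_mul]
        exact hg y
      · rw [ind_false h1, zero_mul]
        exact zero_le_one
    · have := hη' (fun a => {w | l.fill a w ∈ E a}) (fun y => g (l y)) (fun y => hg _)
        fun l' => by simpa only [Subspace.comp_apply] using hE (l.comp l')
      simpa only [Set.mem_ofPred_eq, ← Subspace.fillNone_apply] using this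

/-! ### A Graham–Rothschild type dichotomy for lines -/

section Ramsey

variable {α η θ ι : Type}

/-- The word obtained by putting the letter `b` in front of `y`. -/
def optionCons {β : Type} (b : β) (y : η → β) : Option η → β := fun o => o.elim b y

lemma optionCons_eta {β : Type} (y : Option η → β) :
    optionCons (y none) (fun e => y (some e)) = y := by
  ext (_ | e) <;> rfl

namespace Combinatorics.Subspace

lemma extend_comp (l : Subspace η α ι) (l' : Subspace θ α η) (y : θ → Option α) :
    (l.comp l').extend y = l.extend (l'.extend y) := by
  ext1 i
  cases h : l.idxFun i <;> simp [comp, extend, coe_apply, h]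

/-- Put the constant letter `a` in front of a subspace. -/
def consConst (a : α) (l : Subspace η α ι) : Subspace η α (Option ι) where
  idxFun := optionCons (Sum.inl a) l.idxFun
  proper e := by
    obtain ⟨i, hi⟩ := l.proper e
    exact ⟨some i, hi⟩

lemma extend_consConst (a : α) (l : Subspace η α ι) (y : η → Option α) :
    (l.consConst a).extend y = optionCons (some a) (l.extend y) := by
  ext1 (_ | i) <;> simp [consConst, extend, coe_apply, optionCons]

/-- Put a new variable in front of a subspace. -/
def consVar (l : Subspace η α ι) : Subspace (Option η) α (Option ι) where
  idxFun := optionCons (Sum.inr none) fun i => (l.idxFun i).map id some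
  proper e := by
    cases e with
    | none => exact ⟨none, rfl⟩
    | some e =>
      obtain ⟨i, hi⟩ := l.proper e
      exact ⟨some i, by simp [optionCons, hi]⟩

lemma extend_consVar (l : Subspace η α ι) (b : Option α) (y : η → Option α) :
    l.consVar.extend (optionCons b y) = optionCons b (l.extend y) := by
  ext1 (_ | i)
  · simp [consVar, extend, coe_apply, optionCons]
  · cases h : l.idxFun i <;> simp [consVar, extend, coe_apply, optionCons, h]

end Combinatorics.Subspace

/-- A consequence of the Hales–Jewett theorem: all words starting with a blank in a suitable
subspace have the same colour. -/
lemma exists_mono_optionCons_none (α η κ : Type) [Finite α] [Finite η] [Finite κ] :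
    ∃ (ι : Type) (_ : Finite ι), ∀ C : (ι → Option α) → κ,
      ∃ (l : Subspace (Option η) α (Option ι)) (c : κ), ∀ y : η → Option α,
        ∃ w, l.extend (optionCons none y) = optionCons none w ∧ C w = c := by
  obtain ⟨ι, _, hι⟩ := Subspace.exists_mono_in_high_dimension (Option α) κ η
  refine ⟨ι, inferInstance, fun C => ?_⟩
  obtain ⟨l, c, hl⟩ := hι C
  let f : Option α ⊕ η → α ⊕ Option η :=
    Sum.elim (fun b => b.elim (Sum.inr none) Sum.inl) fun e => Sum.inr (some e)
  refine ⟨⟨optionCons (Sum.inr none) fun i => f (l.idxFun i), ?_⟩, c, fun y => ⟨l y, ?_, hl y⟩⟩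
  · rintro (_ | e)
    · exact ⟨none, rfl⟩
    · obtain ⟨i, hi⟩ := l.proper e
      exact ⟨some i, by simp [optionCons, hi, f]⟩
  · ext1 (_ | i)
    · simp [Subspace.extend, Subspace.coe_apply, optionCons]
    · rcases h : l.idxFun i with (_ | a) | e <;>
        simp [Subspace.extend, Subspace.coe_apply, optionCons, f, h]

/-- For every property `G` of lines, either all lines in a large subspace through its first
coordinate have `G`, or no line in some subspace of the given dimension has `G`. -/
lemma exists_forall_or_forall_not (α : Type) [Finite α] [Nonempty α] (θ : Type) [Finite θ] :
    ∀ (η : Type) [Finite η], ∃ (ι : Type) (_ : Finite ι), ∀ G : (ι → Option α) → Prop,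
      (∃ l : Subspace (Option η) α ι, ∀ y, G (l.extend (optionCons none y))) ∨
      ∃ l : Subspace θ α ι, ∀ y, (∃ j, y j = none) → ¬G (l.extend y) := by
  induction θ using Finite.induction_empty_option with
  | of_equiv e h =>
    intro η _
    obtain ⟨ι, hfin, hι⟩ := h η
    refine ⟨ι, hfin, fun G => (hι G).imp_right ?_⟩
    rintro ⟨l, hl⟩
    refine ⟨l.comp ⟨fun i => Sum.inr (e i), fun i => ⟨e.symm i, by simp⟩⟩, ?_⟩
    rintro y ⟨j, hj⟩
    rw [Subspace.extend_comp]
    exact hl _ ⟨e.symm j, by simpa [Subspace.extend, Subspace.coe_apply] using hj⟩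
  | h_empty =>
    intro η _
    refine ⟨PEmpty, inferInstance, fun G => Or.inr ⟨default, ?_⟩⟩
    rintro y ⟨⟨⟩, _⟩
  | h_option ih =>
    intro η _
    obtain ⟨η₁, _, hη₁⟩ := exists_mono_optionCons_none α η α
    obtain ⟨κ, _, hκ⟩ := ih η₁
    obtain ⟨ι, _, hι⟩ := exists_mono_optionCons_none α (κ ⊕ η) Prop
    refine ⟨Option ι, inferInstance, fun G => ?_⟩
    let a₀ : α := Classical.arbitrary α
    obtain ⟨l, c, hl⟩ := hι fun w => G (optionCons none w)
    have hG : ∀ y, G (l.extend (optionCons none y)) ↔ c := by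
      intro y
      obtain ⟨w, hw, hc⟩ := hl y
      rw [hw, ← hc]
    by_cases hc : c
    · refine Or.inl ⟨l.comp (Subspace.vertical (fun _ => a₀) default).consVar, fun y => ?_⟩
      rw [Subspace.extend_comp, Subspace.extend_consVar, hG]
      exact hc
    obtain ⟨l₁, hl₁G⟩ : ∃ l₁ : Subspace (Option κ) α (Option ι),
        ∀ y, ¬G (l₁.extend (optionCons none y)) := by
      refine ⟨l.comp (Subspace.horizontal default fun _ => a₀).consVar, fun y => ?_⟩
      rw [Subspace.extend_comp, Subspace.extend_consVar, hG]
      exact hc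
    rcases hκ fun w => ∃ a : α, G (l₁.extend (optionCons (some a) w)) with ⟨S, hS⟩ | ⟨S, hS⟩
    · choose A hA using hS
      obtain ⟨R, a, hR⟩ := hη₁ A
      refine Or.inl ⟨l₁.comp ((S.comp R).consConst a), fun y => ?_⟩
      obtain ⟨w, hw, rfl⟩ := hR y
      rw [Subspace.extend_comp, Subspace.extend_consConst, Subspace.extend_comp, hw]
      exact hA w
    · refine Or.inr ⟨l₁.comp S.consVar, ?_⟩
      rintro y ⟨j, hj⟩
      rw [← optionCons_eta y, Subspace.extend_comp, Subspace.extend_consVar]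
      cases hy : y none with
      | none => exact hl₁G _
      | some a =>
        cases j with
        | none => simp [hy] at hj
        | some j => exact fun h => hS _ ⟨j, hj⟩ ⟨a, h⟩

end Ramsey

/-! ### The density Hales–Jewett theorem -/

section DensityHalesJewett

variable {α η ι κ : Type}

/-- Enlarging the alphabet: a large average of `g` is seen on any set defined by conditions each
of which does not distinguish the blank letter from some other letter, as long as `g` has
nonpositive average on all subspaces. -/
lemma DenseSubspace.avg_le_avg_forall_fillNone [Finite α] [Nonempty α]
    (h : DenseSubspace α Unit) (η : Type) [Finite η] (c : ℝ) (hc : 0 < c) :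
    ∃ (ι : Type) (_ : Finite ι), ∀ (E : α → Set (ι → α)) (g : (ι → Option α) → ℝ),
      (∀ y, g y ≤ 1) → (∀ l : Subspace η (Option α) ι, avg (fun x => g (l x)) ≤ 0) →
      avg g ≤ avg (fun y => ind (∀ a, fillNone a y ∈ E a) * g y) + c := by
  classical
  let := Fintype.ofFinite α
  have hS : (0 : ℝ) < Fintype.card (Finset α) := by exact_mod_cast Fintype.card_pos
  obtain ⟨ι, hfin, hι⟩ := h.avg_forall_fillNone_le η Finset.univ
    (c / Fintype.card (Finset α)) (by positivity)
  refine ⟨ι, hfin, fun E g hg hl => ?_⟩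
  let D : Finset α → α → Set (ι → α) := fun s a => {w | w ∈ E a ↔ a ∈ s}
  have hD : ∀ y, g y = ∑ s : Finset α, ind (∀ a ∈ Finset.univ, fillNone a y ∈ D s a) * g y := by
    intro y
    rw [Finset.sum_eq_single (Finset.univ.filter fun a => fillNone a y ∈ E a), ind_true, one_mul]
    · intro a _
      simp [D]
    · intro s _ hs
      rw [ind_false, zero_mul]
      intro hy
      refine hs ?_
      ext a
      simpa [D] using (hy a (Finset.mem_univ a)).symm
    · simp
  calc avg g = ∑ s : Finset α,
        avg fun y => ind (∀ a ∈ Finset.univ, fillNone a y ∈ D s a) * g y := by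
        rw [← avg_sum]
        exact avg_congr hD
    _ = avg (fun y => ind (∀ a, fillNone a y ∈ E a) * g y) +
        ∑ s ∈ Finset.univ.erase Finset.univ,
          avg fun y => ind (∀ a ∈ Finset.univ, fillNone a y ∈ D s a) * g y := by
        rw [← Finset.add_sum_erase _ _ (Finset.mem_univ Finset.univ)]
        simp [D]
    _ ≤ _ := by
        gcongr
        refine (Finset.sum_le_card_nsmul _ _ _ fun s _ => hι (D s) g hg hl).trans ?_
        rw [nsmul_eq_mul, mul_div_assoc', div_le_iff₀ hS, mul_comm c]
        gcongr
        exact Finset.card_le_univ _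

/-- If all the sets in a family indexed by words have positive density, then along some line
their intersection has density bounded below. -/
lemma DenseSubspace.exists_le_avg_forall [Finite α] [Nonempty α] (h : DenseSubspace α Unit)
    (δ : ℝ) (hδ : 0 < δ) :
    ∃ (ι : Type) (_ : Finite ι) (θ : ℝ), 0 < θ ∧ θ ≤ 1 ∧ ∀ (Z : Type) [Finite Z] [Nonempty Z]
      (T : (ι → α) → Set Z), (∀ x, δ ≤ avg fun z => ind (z ∈ T x)) →
      ∃ y : ι → Option α, (∃ i, y i = none) ∧
        θ ≤ avg fun z => ind (∀ a, z ∈ T (fillNone a y)) := by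
  classical
  obtain ⟨ι, hfin, hι⟩ := h (δ / 2) (by positivity)
  let := Fintype.ofFinite (ι → Option α)
  have hK : (0 : ℝ) < Fintype.card (ι → Option α) := by exact_mod_cast Fintype.card_pos
  refine ⟨ι, hfin, min (δ / 2 / (Fintype.card (ι → Option α) + 1)) 1, by positivity,
    min_le_right _ _, ?_⟩
  intro Z _ _ T hT
  by_contra! hcon
  have h1 : δ ≤ avg fun z => avg fun x => ind (z ∈ T x) := by
    rw [avg_comm]
    exact const_le_avg hT
  have h2 := sub_le_avg_ind (f := fun z => avg fun x => ind (z ∈ T x))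
    (fun z => avg_le_const fun x => ind_le_one _) (δ / 2) (by positivity)
  have h3 : avg (fun z => ind (δ / 2 ≤ avg fun x => ind (z ∈ T x))) ≤
      ∑ y : ι → Option α,
        avg fun z => ind ((∃ i, y i = none) ∧ ∀ a, z ∈ T (fillNone a y)) := by
    rw [← avg_sum]
    refine avg_mono fun z => ?_
    by_cases hz : δ / 2 ≤ avg fun x => ind (z ∈ T x)
    · obtain ⟨l, hl⟩ := hι {x | z ∈ T x} hz
      let y : ι → Option α := fun i => (l.idxFun i).elim some fun _ => none
      have hy : (∃ i, y i = none) ∧ ∀ a, z ∈ T (fillNone a y) := by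
        refine ⟨?_, fun a => ?_⟩
        · obtain ⟨i, hi⟩ := l.proper ()
          exact ⟨i, by simp [y, hi]⟩
        · have : fillNone a y = l fun _ => a := by
            ext1 i
            cases h : l.idxFun i <;> simp [fillNone, y, Subspace.coe_apply, h]
          rw [this]
          exact hl fun _ => a
      rw [ind_true hz, ← ind_true hy]
      exact Finset.single_le_sum
        (f := fun y : ι → Option α => ind ((∃ i, y i = none) ∧ ∀ a, z ∈ T (fillNone a y)))
        (fun _ _ => ind_nonneg _) (Finset.mem_univ y)
    · rw [ind_false hz]
      exact Finset.sum_nonneg fun _ _ => ind_nonneg _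
  have h4 : ∀ y : ι → Option α,
      avg (fun z => ind ((∃ i, y i = none) ∧ ∀ a, z ∈ T (fillNone a y))) ≤
        δ / 2 / (Fintype.card (ι → Option α) + 1) := by
    intro y
    by_cases hy : ∃ i, y i = none
    · simp only [hy, true_and]
      exact (hcon y hy).le.trans (min_le_left _ _)
    · simp only [hy, false_and, ind_false not_false, avg_const]
      positivity
  have h5 := Finset.sum_le_sum fun y (_ : y ∈ Finset.univ) => h4 y
  rw [Finset.sum_const, Finset.card_univ, nsmul_eq_mul] at h5
  have h6 : (Fintype.card (ι → Option α) : ℝ) *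
      (δ / 2 / (Fintype.card (ι → Option α) + 1)) < δ / 2 := by
    rw [mul_div_assoc', div_lt_iff₀ (by positivity)]
    nlinarith
  linarith

/-- A set of words containing no combinatorial line. -/
def LineFree (A : Set (ι → α)) : Prop := ¬∃ l : Subspace Unit α ι, ∀ x, l x ∈ A

lemma LineFree.preimage {A : Set (ι → α)} (hA : LineFree A) (l : Subspace η α ι) :
    LineFree {x : η → α | l x ∈ A} := by
  rintro ⟨l', hl'⟩
  exact hA ⟨l.comp l', fun x => by rw [Subspace.comp_apply]; exact hl' x⟩

lemma LineFree.fibre {A : Set (ι ⊕ κ → α)} (hA : LineFree A) (u : ι → α) :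
    LineFree {z | Sum.elim u z ∈ A} := by
  rintro ⟨l, hl⟩
  exact hA ⟨l.vertical u, fun x => by rw [Subspace.vertical_apply]; exact hl x⟩

lemma LineFree.exists_not_mem {A : Set (ι ⊕ κ → Option α)} (hA : LineFree A) {v : ι → Option α}
    {i : ι} (hi : v i = none) {z : κ → Option α} (hz : Sum.elim v z ∈ A) :
    ∃ a, Sum.elim (fun i => some (fillNone a v i)) z ∉ A := by
  by_contra! h
  let f : Option α → Option α ⊕ Unit := fun b => b.elim (Sum.inr ()) fun a => Sum.inl (some a)
  let l : Subspace Unit (Option α) (ι ⊕ κ) :=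
    ⟨Sum.elim (fun i => f (v i)) fun k => Sum.inl (z k), fun _ => ⟨Sum.inl i, by simp [f, hi]⟩⟩
  refine hA ⟨l, fun x => ?_⟩
  cases hx : x () with
  | none =>
    convert! hz
    ext1 (j | j)
    · cases hj : v j <;> simp [l, f, Subspace.coe_apply, hj, hx]
    · simp [l, Subspace.coe_apply]
  | some a =>
    convert! h a
    ext1 (j | j)
    · cases hj : v j <;> simp [l, f, Subspace.coe_apply, fillNone, hj, hx]
    · simp [l, Subspace.coe_apply]

/-- A function with average close to its upper bound is everywhere close to this bound. -/
lemma sub_card_mul_le {X : Type*} [Finite X] {f : X → ℝ} {b : ℝ} (hb : ∀ x, f x ≤ b) (x : X) :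
    b - Nat.card X * (b - avg f) ≤ f x := by
  let := Fintype.ofFinite X
  have : Nonempty X := ⟨x⟩
  have h := Finset.single_le_sum (f := fun x => b - f x) (fun x _ => sub_nonneg.2 (hb x))
    (Finset.mem_univ x)
  have hX : (Fintype.card X : ℝ) ≠ 0 := by exact_mod_cast Fintype.card_ne_zero
  rw [avg_eq_sum, Nat.card_eq_fintype_card, mul_sub, mul_div_cancel₀ _ hX]
  rw [Finset.sum_sub_distrib, Finset.sum_const, Finset.card_univ, nsmul_eq_mul] at h
  linarith

/-- The supremal density of line-free sets in high dimensions. -/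
lemma exists_density_of_not_denseSubspace [Finite α] [Nonempty α]
    (h : ¬DenseSubspace α Unit) :
    ∃ δ : ℝ, 0 < δ ∧ ∀ γ : ℝ, 0 < γ →
      (∃ (ι : Type) (_ : Finite ι), ∀ A : Set (ι → α), LineFree A →
        avg (fun x => ind (x ∈ A)) ≤ δ + γ) ∧
      ∀ (ι : Type) [Finite ι], ∃ A : Set (ι → α), LineFree A ∧
        δ - γ ≤ avg (fun x => ind (x ∈ A)) := by
  let S : Set ℝ := {δ | ∀ (ι : Type) [Finite ι], ∃ A : Set (ι → α), LineFree A ∧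
    δ ≤ avg (fun x => ind (x ∈ A))}
  have hS : BddAbove S := by
    refine ⟨1, fun δ hδ => ?_⟩
    obtain ⟨A, -, hA⟩ := hδ Empty
    exact hA.trans (avg_le_const fun _ => ind_le_one _)
  simp only [DenseSubspace, not_forall, not_exists] at h
  obtain ⟨δ₀, hδ₀, h⟩ := h
  have hδ₀S : δ₀ ∈ S := by
    intro ι _
    obtain ⟨A, hA, hl⟩ := h ι ‹_›
    exact ⟨A, fun ⟨l, hl'⟩ => by simpa [hl'] using hl l, hA⟩
  refine ⟨sSup S, hδ₀.trans_le (le_csSup hS hδ₀S), fun γ hγ => ⟨?_, ?_⟩⟩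
  · by_contra! hcon
    have := le_csSup hS (show sSup S + γ ∈ S from fun ι hι => by
      obtain ⟨A, hA, hlA⟩ := hcon ι hι
      exact ⟨A, hA, hlA.le⟩)
    linarith
  · intro ι _
    obtain ⟨δ, hδ, hlt⟩ := exists_lt_of_lt_csSup ⟨δ₀, hδ₀S⟩ (sub_lt_self (sSup S) hγ)
    obtain ⟨A, hA, hlA⟩ := hδ ι
    exact ⟨A, hA, hlt.le.trans hlA⟩

/-- The density Hales–Jewett theorem: adding a letter to the alphabet. -/
lemma DenseSubspace.option_alphabet [Finite α] [Nonempty α] (h : DenseSubspace α Unit) :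
    DenseSubspace (Option α) Unit := by
  by_contra hcon
  obtain ⟨δ, hδ, hext⟩ := exists_density_of_not_denseSubspace hcon
  obtain ⟨L, _, θ, hθ, hθ1, hL⟩ := h.exists_le_avg_forall (δ / 2) (by positivity)
  have hδθ : 0 < δ * θ := by positivity
  obtain ⟨⟨d, _, hd⟩, -⟩ := hext (δ * θ / 4) (by positivity)
  obtain ⟨m, _, hm⟩ := h.avg_le_avg_forall_fillNone d (δ * θ / 4) (by positivity)
  obtain ⟨N, _, hN⟩ := exists_forall_or_forall_not α L m
  have hW : (0 : ℝ) < Nat.card (N → Option α) := by exact_mod_cast Nat.card_pos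
  obtain ⟨⟨n, _, hn⟩, -⟩ := hext (δ * θ / (16 * Nat.card (N → Option α))) (by positivity)
  obtain ⟨-, hA⟩ := hext (δ * θ / (16 * Nat.card (N → Option α))) (by positivity)
  obtain ⟨A, hAl, hA⟩ := hA (N ⊕ n)
  let μ : (N → Option α) → ℝ := fun u => avg fun z : n → Option α => ind (Sum.elim u z ∈ A)
  have hμ : ∀ u, δ - δ * θ / 8 ≤ μ u := by
    intro u
    have h1 := sub_card_mul_le (f := μ) (b := δ + δ * θ / (16 * Nat.card (N → Option α)))
      (fun u => hn _ (hAl.fibre u)) u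
    rw [avg_sumElim] at hA
    have h2 : Nat.card (N → Option α) * (δ * θ / (16 * Nat.card (N → Option α))) =
        δ * θ / 16 := by
      field_simp
    have h3 : 0 < δ * θ / (16 * Nat.card (N → Option α)) := by positivity
    have h4 := mul_le_mul_of_nonneg_left hA hW.le
    change _ ≤ _ * avg μ at h4
    nlinarith
  rcases hN fun v => θ ≤ avg fun z : n → Option α =>
    ind (∀ a, Sum.elim (fun i => some (fillNone a v i)) z ∈ A) with ⟨l, hl⟩ | ⟨l, hl⟩
  · let B : (n → Option α) → Set (m → Option α) := fun z =>
      {y | Sum.elim (l.extend (optionCons none y)) z ∈ A}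
    let E : (n → Option α) → α → Set (m → α) := fun z a =>
      {w | Sum.elim (fun i => some (l (optionCons a w) i)) z ∈ A}
    have hfill : ∀ a (y : m → Option α),
        fillNone a (l.extend (optionCons none y)) = l (optionCons a (fillNone a y)) := by
      intro a y
      rw [Subspace.fillNone_extend]
      congr 1
      ext1 (_ | i) <;> rfl
    have hEy : ∀ z a y, fillNone a y ∈ E z a ↔
        Sum.elim (fun i => some (fillNone a (l.extend (optionCons none y)) i)) z ∈ A := by
      intro z a y
      rw [hfill]
      rfl
    have hBl : ∀ z, LineFree (B z) := by
      intro z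
      have := hAl.preimage ((l.extend.comp ((default : Subspace m (Option α) m).consConst
        none)).horizontal z)
      convert! this using 3 with y
      rw [Subspace.horizontal_apply, Subspace.comp_apply]
      congr! 3
      ext1 (_ | i) <;> simp [Subspace.consConst, Subspace.coe_apply, optionCons]
      rfl
    have hBE : ∀ z y, y ∈ B z → ¬∀ a, fillNone a y ∈ E z a := by
      intro z y hy
      obtain ⟨i, hi⟩ := l.proper none
      obtain ⟨a, ha⟩ := hAl.exists_not_mem
        (show l.extend (optionCons none y) i = none by
          simp [Subspace.extend, Subspace.coe_apply, hi, optionCons]) hy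
      exact fun h => ha ((hEy z a y).1 (h a))
    have hBavg : δ - δ * θ / 8 ≤ avg fun z => avg fun y => ind (y ∈ B z) := by
      rw [avg_comm]
      exact const_le_avg fun y => hμ _
    have hEavg : θ ≤ avg fun z => avg fun y => ind (∀ a, fillNone a y ∈ E z a) := by
      rw [avg_comm]
      simp only [hEy]
      exact const_le_avg hl
    set δ' := δ + δ * θ / 4 with hδ'
    obtain ⟨z, hz⟩ := exists_le_of_le_avg
      (show δ - δ * θ / 8 + δ' * θ ≤ avg fun z => (avg fun y => ind (y ∈ B z)) +
        δ' * avg fun y => ind (∀ a, fillNone a y ∈ E z a) by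
      rw [avg_add, avg_const_mul]
      gcongr)
    have := hm (E z) (fun y => ind (y ∈ B z) - δ')
      (fun y => by linarith [ind_le_one (y ∈ B z), show 0 < δ' by positivity]) fun l' => by
        rw [avg_sub, avg_const, sub_nonpos]
        exact hd _ ((hBl z).preimage l')
    rw [avg_sub, avg_const] at this
    have h1 : avg (fun y => ind (∀ a, fillNone a y ∈ E z a) * (ind (y ∈ B z) - δ')) =
        -δ' * avg fun y => ind (∀ a, fillNone a y ∈ E z a) := by
      rw [← avg_const_mul]
      refine avg_congr fun y => ?_
      by_cases hy : y ∈ B z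
      · rw [ind_false (hBE z y hy), zero_mul, mul_zero]
      · rw [ind_false hy]
        ring
    rw [h1] at this
    nlinarith
  · obtain ⟨y, hy, hyl⟩ := hL (n → Option α)
      (fun x => {z | Sum.elim (fun i => some (l x i)) z ∈ A}) fun x => by
        refine le_trans ?_ (hμ fun i => some (l x i))
        nlinarith
    refine hl y hy ?_
    simpa only [Subspace.fillNone_extend, Set.mem_ofPred_eq] using hyl

/-- The density Hales–Jewett theorem does not depend on the names of the letters. -/
lemma DenseSubspace.of_equiv_alphabet {β : Type} [Finite α] [Finite β] (e : α ≃ β)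
    (h : DenseSubspace α η) : DenseSubspace β η := by
  intro δ hδ
  obtain ⟨ι, hfin, hι⟩ := h δ hδ
  refine ⟨ι, hfin, fun A hA => ?_⟩
  obtain ⟨l, hl⟩ := hι {x | e ∘ x ∈ A} (hA.trans_eq
    (avg_equiv (Equiv.piCongrRight fun _ : ι => e) fun x => ind (x ∈ A)).symm)
  refine ⟨l.reindex (Equiv.refl _) e (Equiv.refl _), fun x => ?_⟩
  have : l.reindex (Equiv.refl η) e (Equiv.refl ι) x = e ∘ l (e.symm ∘ x) := by
    ext1 i
    simp
  rw [this]
  exact hl (e.symm ∘ x)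

/-- The **density Hales–Jewett theorem**. -/
theorem denseSubspace_unit (α : Type) [Finite α] : DenseSubspace α Unit := by
  suffices h : ∀ _ : Finite α, DenseSubspace α Unit from h _
  induction α using Finite.induction_empty_option with
  | of_equiv e h =>
    intro _
    have := Finite.of_equiv _ e.symm
    exact (h this).of_equiv_alphabet e
  | h_empty =>
    exact fun _ δ hδ => ⟨Unit, inferInstance, fun A hA => ⟨default, fun x => (x ()).elim⟩⟩
  | @h_option α _ h =>
    intro _
    rcases isEmpty_or_nonempty α with hα | hα
    · intro δ hδ
      refine ⟨Unit, inferInstance, fun A hA => ⟨default, fun x => ?_⟩⟩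
      obtain ⟨y, hy⟩ := exists_le_of_le_avg hA
      rw [Subsingleton.elim (Subspace.toFun _ x) y]
      by_contra hyA
      rw [ind_false hyA] at hy
      linarith
    · exact (h inferInstance).option_alphabet

end DensityHalesJewett

/-! ### Tuples of vectors all of whose linear combinations lie in a dense set of points -/

section GoodTuples

variable {F : Type} [Field F] {V : Type*} [AddCommGroup V] [Module F V]

/-- Every nonzero coefficient vector gives a linear combination of `v` that lies in `M`. -/
def NonzeroCombMem (F : Type) [Field F] {V : Type*} [AddCommGroup V] [Module F V] (M : Set V)
    {j : ℕ} (v : Fin j → V) : Prop :=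
  ∀ a : Fin j → F, a ≠ 0 → ∑ i, a i • v i ∈ M

lemma NonzeroCombMem.cons {M : Set V} (hM : ∀ (a : F) (x : V), a ≠ 0 → x ∈ M → a • x ∈ M)
    {j : ℕ} {v : Fin j → V} (hv : NonzeroCombMem F M v) {x : V}
    (hx : ∀ a : Fin j → F, x + ∑ i, a i • v i ∈ M) :
    NonzeroCombMem F M (Fin.cons x v : Fin (j + 1) → V) := by
  intro a ha
  rw [Fin.sum_univ_succ]
  simp only [Fin.cons_zero, Fin.cons_succ]
  by_cases h0 : a 0 = 0
  · rw [h0, zero_smul, zero_add]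
    refine hv (fun i => a i.succ) fun h => ha ?_
    ext i
    exact Fin.cases h0 (congrFun h) i
  · have := hM (a 0) _ h0 (hx fun i => (a 0)⁻¹ * a i.succ)
    simpa only [smul_add, Finset.smul_sum, smul_smul, mul_inv_cancel_left₀ h0] using this

lemma pow_le_avg_nonzeroCombMem [Fintype F] [Finite V] {M : Set V}
    (hM : ∀ (a : F) (x : V), a ≠ 0 → x ∈ M → a • x ∈ M) {c : ℕ} {ε : ℝ} (hε : 0 ≤ ε)
    (hd : (Fintype.card F : ℝ) ^ (c - 1) * avg (fun x => ind (x ∉ M)) ≤ 1 - ε)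
    (j : ℕ) (hj : j ≤ c) : ε ^ j ≤ avg fun v : Fin j → V => ind (NonzeroCombMem F M v) := by
  have hV : Nonempty V := ⟨0⟩
  induction j with
  | zero =>
    rw [pow_zero]
    refine const_le_avg fun v => (ind_true fun a ha => ?_).ge
    exact absurd (Subsingleton.elim a 0) ha
  | succ j ih =>
    have hq : (1 : ℝ) ≤ Fintype.card F := by exact_mod_cast Fintype.card_pos
    have hB0 : 0 ≤ avg (fun x => ind (x ∉ M)) := avg_nonneg fun x => ind_nonneg _
    rw [← avg_equiv (Fin.consEquiv fun _ => V), avg_prod, avg_comm, pow_succ, mul_comm]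
    refine (mul_le_mul_of_nonneg_left (ih (by omega)) hε).trans ?_
    rw [← avg_const_mul]
    refine avg_mono fun v => ?_
    by_cases hv : NonzeroCombMem F M v
    · rw [ind_true hv, mul_one]
      have h1 : avg (fun x => 1 - ∑ a : Fin j → F, ind (x + ∑ i, a i • v i ∉ M)) ≤
          avg fun x : V => ind (NonzeroCombMem F M (Fin.consEquiv (fun _ => V) (x, v))) := by
        refine avg_mono fun x => ?_
        by_cases hx : ∀ a : Fin j → F, x + ∑ i, a i • v i ∈ M
        · rw [ind_true (show NonzeroCombMem F M (Fin.consEquiv (fun _ => V) (x, v)) from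
            hv.cons hM hx)]
          linarith [Finset.sum_nonneg fun (a : Fin j → F) (_ : a ∈ Finset.univ) =>
            ind_nonneg (x + ∑ i, a i • v i ∉ M)]
        · push Not at hx
          obtain ⟨a, ha⟩ := hx
          have h2 := Finset.single_le_sum (f := fun a : Fin j → F => ind (x + ∑ i, a i • v i ∉ M))
            (fun _ _ => ind_nonneg _) (Finset.mem_univ a)
          simp only [ind_true ha] at h2
          linarith [ind_nonneg (NonzeroCombMem F M (Fin.consEquiv (fun _ => V) (x, v)))]
      refine le_trans ?_ h1
      have h3 : ∀ a : Fin j → F, avg (fun x => ind (x + ∑ i, a i • v i ∉ M)) =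
          avg (fun x => ind (x ∉ M)) := fun a =>
        avg_equiv (Equiv.addRight (∑ i, a i • v i)) fun x => ind (x ∉ M)
      rw [avg_sub, avg_const, avg_sum]
      simp only [h3, Finset.sum_const, Finset.card_univ, Fintype.card_fun, Fintype.card_fin,
        nsmul_eq_mul, Nat.cast_pow]
      have h4 := mul_le_mul_of_nonneg_right
        (pow_le_pow_right₀ hq (show j ≤ c - 1 by omega)) hB0
      linarith
    · rw [ind_false hv, mul_zero]
      exact avg_nonneg fun _ => ind_nonneg _

/-- The density Hales–Jewett theorem applied to tuples of vectors. -/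
lemma exists_forall_nonzeroCombMem (F : Type) [Field F] [Fintype F] (c d : ℕ) (δ : ℝ)
    (hδ : 0 < δ) :
    ∃ N : ℕ, ∀ n : ℕ, N ≤ n → ∀ M : Set (Fin n → F),
      (δ ≤ avg fun v : Fin c → Fin n → F => ind (NonzeroCombMem F M v)) →
      ∃ (v : Fin c → Fin n → F) (Ψ : (Fin d → F) →ₗ[F] (Fin n → F)), Function.Injective Ψ ∧
        ∀ a : Fin c → Fin d → F, NonzeroCombMem F M fun j => v j + Ψ (a j) := by
  classical
  obtain ⟨ι, _, hι⟩ := denseSubspace_unit (Fin c → Fin d → F) δ hδ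
  let := Fintype.ofFinite ι
  refine ⟨Fintype.card (ι × Fin d), fun n hn M hM => ?_⟩
  obtain ⟨e⟩ : Nonempty (ι × Fin d ↪ Fin n) :=
    Function.Embedding.nonempty_of_card_le (by simpa using hn)
  let Φ : (ι × Fin d → F) →ₗ[F] (Fin n → F) := Function.ExtendByZero.linearMap F e
  have hΦ : Function.Injective Φ := fun x y h => by
    ext p
    simpa [Φ, e.injective.extend_apply] using congrFun h (e p)
  let t : (ι → Fin c → Fin d → F) → Fin c → Fin n → F := fun w j => Φ fun p => w p.1 j p.2
  have h1 : δ ≤ avg fun b : Fin c → Fin n → F =>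
      avg fun w => ind (NonzeroCombMem F M (b + t w)) := by
    rw [avg_comm]
    refine const_le_avg fun w => hM.trans_eq ?_
    exact (avg_equiv (Equiv.addRight (t w)) fun v => ind (NonzeroCombMem F M v)).symm
  obtain ⟨b, hb⟩ := exists_le_of_le_avg h1
  obtain ⟨l, hl⟩ := hι {w | NonzeroCombMem F M (b + t w)} hb
  obtain ⟨i₀, hi₀⟩ := l.proper ()
  let P : (Fin d → F) →ₗ[F] (ι × Fin d → F) :=
    LinearMap.pi fun p => if l.idxFun p.1 = Sum.inr () then LinearMap.proj p.2 else 0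
  refine ⟨b + t (l fun _ => 0), Φ.comp P, ?_, fun a => ?_⟩
  · refine hΦ.comp fun x y h => ?_
    ext k
    simpa [P, hi₀] using congrFun h (i₀, k)
  · have h2 : (fun j => (b + t (l fun _ => 0)) j + Φ.comp P (a j)) = b + t (l fun _ => a) := by
      ext1 j
      simp only [Pi.add_apply, t, LinearMap.comp_apply, add_assoc, ← map_add]
      congr 2
      ext ⟨i, k⟩
      rcases h : l.idxFun i with x | ⟨⟩ <;> simp [P, h, Subspace.coe_apply]
    rw [h2]
    exact hl fun _ => a

end GoodTuples

/-! ### Sets of projective points -/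

section Points

variable {F : Type} [Field F] {n : ℕ}

/-- The nonzero vectors representing a point of `M`. -/
def pgVectors (M : Set (Projectivization F (Fin n → F))) : Set (Fin n → F) :=
  {v | ∃ hv : v ≠ 0, Projectivization.mk F v hv ∈ M}

lemma smul_mem_pgVectors {M : Set (Projectivization F (Fin n → F))} (a : F) (v : Fin n → F)
    (ha : a ≠ 0) (hv : v ∈ pgVectors M) : a • v ∈ pgVectors M := by
  obtain ⟨hv, hM⟩ := hv
  refine ⟨smul_ne_zero ha hv, ?_⟩
  convert! hM using 1
  rw [Projectivization.mk_eq_mk_iff']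
  exact ⟨a, rfl⟩

lemma ncard_mul_le_card_pgVectors [Fintype F] (M : Set (Projectivization F (Fin n → F))) :
    (M.ncard : ℝ) * (Fintype.card F - 1) ≤ Nat.card (pgVectors M) := by
  classical
  let f : M × Fˣ → pgVectors M := fun p => ⟨p.2 • p.1.1.rep, by
    refine smul_mem_pgVectors _ _ p.2.ne_zero ⟨p.1.1.rep_nonzero, ?_⟩
    rw [Projectivization.mk_rep]
    exact p.1.2⟩
  have hf : Function.Injective f := by
    rintro ⟨⟨x, hx⟩, u⟩ ⟨⟨y, hy⟩, w⟩ h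
    have h : u • x.rep = w • y.rep := congrArg Subtype.val h
    have hxy : x = y := by
      rw [← x.mk_rep, ← y.mk_rep, Projectivization.mk_eq_mk_iff]
      exact ⟨u⁻¹ * w, by rw [mul_smul, ← h, inv_smul_smul]⟩
    subst hxy
    have huw : u = w := Units.ext (smul_left_injective F x.rep_nonzero h)
    rw [huw]
  have h1 := Nat.card_le_card_of_injective f hf
  rw [Nat.card_prod, Nat.card_coe_set_eq, Nat.card_eq_fintype_card (α := Fˣ),
    Fintype.card_units] at h1
  have h2 : 1 ≤ Fintype.card F := Fintype.card_pos
  have h3 : ((M.ncard * (Fintype.card F - 1) : ℕ) : ℝ) ≤ Nat.card (pgVectors M) := by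
    exact_mod_cast h1
  rwa [Nat.cast_mul, Nat.cast_sub h2, Nat.cast_one] at h3

lemma avg_notMem_pgVectors_le [Fintype F] (M : Set (Projectivization F (Fin n → F))) :
    avg (fun v => ind (v ∉ pgVectors M)) ≤
      1 - M.ncard * (Fintype.card F - 1) / (Fintype.card F : ℝ) ^ n := by
  have h1 : avg (fun v => ind (v ∈ pgVectors M)) =
      Nat.card (pgVectors M) / (Fintype.card F : ℝ) ^ n := by
    rcases isEmpty_or_nonempty (pgVectors M) with h | h
    · rw [Nat.card_of_isEmpty, Nat.cast_zero, zero_div,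
        avg_congr fun v => ind_false fun hv => h.false ⟨v, hv⟩, avg_const]
    · have := avg_range_one (Subtype.val : pgVectors M → Fin n → F) Subtype.val_injective
      simpa using this
  simp only [ind_not, avg_sub, avg_const, h1]
  gcongr
  exact ncard_mul_le_card_pgVectors M

lemma pgContains_pgDel {c d : ℕ} {M : Set (Projectivization F (Fin n → F))}
    {v : Fin c → Fin n → F} {Ψ : (Fin d → F) →ₗ[F] (Fin n → F)} (hΨ : Function.Injective Ψ)
    (h : ∀ a : Fin c → Fin d → F, NonzeroCombMem F (pgVectors M) fun j => v j + Ψ (a j)) :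
    PGContains F (d + c) n (pgDel F (d + c) c) M := by
  classical
  have key : ∀ (u : Fin d → F) (b : Fin c → F), b ≠ 0 →
      ∑ j, b j • v j + Ψ u ∈ pgVectors M := by
    intro u b hb
    obtain ⟨j₀, hj₀⟩ := Function.ne_iff.1 hb
    convert! h (Pi.single j₀ ((b j₀)⁻¹ • u)) b hb using 1
    simp only [smul_add, Finset.sum_add_distrib]
    rw [Finset.sum_eq_single j₀ (f := fun j => b j • Ψ _)]
    · rw [Pi.single_eq_same, map_smul, smul_smul, mul_inv_cancel₀ hj₀, one_smul]
    · intro j _ hj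
      rw [Pi.single_eq_of_ne hj, map_zero, smul_zero]
    · simp
  let f : (Fin (d + c) → F) →ₗ[F] (Fin n → F) :=
    (Fintype.linearCombination F v).comp (LinearMap.funLeft F F (Fin.natAdd d)) +
      Ψ.comp (LinearMap.funLeft F F (Fin.castAdd c))
  have hf_mem : ∀ x, (fun j => x (Fin.natAdd d j)) ≠ 0 → f x ∈ pgVectors M := fun x hx =>
    key (fun i => x (Fin.castAdd c i)) _ hx
  have hf : Function.Injective f := by
    rw [injective_iff_map_eq_zero]
    intro x hx
    have h1 : (fun j => x (Fin.natAdd d j)) = 0 := by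
      by_contra hne
      obtain ⟨h0, -⟩ := hf_mem x hne
      exact h0 hx
    have h2 : Ψ (fun i => x (Fin.castAdd c i)) = 0 := by
      have h3 : f x = ∑ j, x (Fin.natAdd d j) • v j + Ψ (fun i => x (Fin.castAdd c i)) := rfl
      have h4 : ∀ j, x (Fin.natAdd d j) = 0 := congrFun h1
      simpa [h4, hx] using h3.symm
    have h5 := (injective_iff_map_eq_zero Ψ).1 hΨ _ h2
    ext i
    exact Fin.addCases (congrFun h5) (congrFun h1) i
  refine ⟨f, hf, fun x hx => ?_⟩
  induction x using Projectivization.ind with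
  | h x hx0 =>
    obtain ⟨_, hM⟩ := hf_mem x fun hzero => hx (by
      rw [Projectivization.submodule_mk, Submodule.span_singleton_le_iff_mem, stdSubspace,
        LinearMap.mem_ker]
      ext ⟨i, hi⟩
      rw [Nat.add_sub_cancel] at hi
      have hi' : Fin.natAdd d ⟨i - d, by omega⟩ = i := by
        ext
        simp [Nat.add_sub_cancel' hi]
      simpa [hi', LinearMap.funLeft_apply] using congrFun hzero ⟨i - d, by omega⟩)
    exact hM

end Points

/-- For each prime power `q = |F|`, integers `m > c ≥ 1`, and real `ε > 0`, there is `R`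
such that `ex_q(G(m-1,q,c); n) < (1 - q^(1-c) + ε)(q^n - 1)/(q - 1)` for all `n > R`. -/
theorem erdos_stone_geometries_reformulation (F : Type) [Field F] [Fintype F]
    (m c : ℕ) (hc : 1 ≤ c) (hcm : c < m) (ε : ℝ) (hε : 0 < ε) :
    ∃ R : ℕ, ∀ n : ℕ, R < n →
      (pgEx F m (pgDel F m c) n : ℝ) <
        (1 - (Fintype.card F : ℝ) ^ (1 - (c : ℤ)) + ε) *
          (((Fintype.card F : ℝ) ^ n - 1) / ((Fintype.card F : ℝ) - 1)) := by
  obtain ⟨d, rfl⟩ := Nat.exists_eq_add_of_le' hcm.le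
  set q : ℝ := (Fintype.card F : ℝ) with hq
  have hq1 : 1 < q := by
    rw [hq]
    exact_mod_cast Fintype.one_lt_card
  obtain ⟨N, hN⟩ := exists_forall_nonzeroCombMem F c d ((ε / 2) ^ c) (by positivity)
  obtain ⟨K, hK⟩ := pow_unbounded_of_one_lt (2 * (1 + ε) / ε) hq1
  refine ⟨max N K, fun n hn => ?_⟩
  have hqn : 2 * (1 + ε) ≤ q ^ n * ε := by
    have h1 : q ^ K ≤ q ^ n := pow_le_pow_right₀ hq1.le (by omega)
    rw [div_lt_iff₀ hε] at hK
    nlinarith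
  have hpow : q ^ (1 - (c : ℤ)) = (q ^ (c - 1))⁻¹ := by
    rw [← zpow_natCast, ← zpow_neg]
    congr 1
    omega
  have hc1 : 1 ≤ q ^ (c - 1) := one_le_pow₀ hq1.le
  have hp0 : 0 < (q ^ (c - 1))⁻¹ := by positivity
  have hp1 : (q ^ (c - 1))⁻¹ ≤ 1 := inv_le_one_of_one_le₀ hc1
  have hqn1 : 1 < q ^ n := one_lt_pow₀ hq1 (by omega)
  rw [hpow]
  set p := (q ^ (c - 1))⁻¹ with hp
  have hmain : ∀ M : Set (Projectivization F (Fin n → F)),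
      ¬PGContains F (d + c) n (pgDel F (d + c) c) M →
        (M.ncard : ℝ) < (1 - p + ε) * ((q ^ n - 1) / (q - 1)) := by
    intro M hM
    by_contra! hcard
    rw [mul_div_assoc', div_le_iff₀ (by linarith)] at hcard
    have hd := avg_notMem_pgVectors_le M
    have h1 : avg (fun v => ind (v ∉ pgVectors M)) ≤ p - ε / 2 := by
      refine hd.trans ?_
      rw [sub_le_comm, le_div_iff₀ (by positivity)]
      refine le_trans ?_ hcard
      nlinarith
    obtain ⟨v, Ψ, hΨ, h⟩ := hN n (by omega) (pgVectors M)
      (pow_le_avg_nonzeroCombMem smul_mem_pgVectors (c := c) (by positivity) (by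
        refine (mul_le_mul_of_nonneg_left h1 (by positivity)).trans ?_
        rw [mul_sub, hp, mul_inv_cancel₀ (by positivity)]
        nlinarith) c le_rfl)
    exact hM (pgContains_pgDel hΨ h)
  rw [pgEx]
  set S : Set ℕ := {k | ∃ M : Set (Projectivization F (Fin n → F)),
    ¬PGContains F (d + c) n (pgDel F (d + c) c) M ∧ M.ncard = k} with hS
  rcases S.eq_empty_or_nonempty with hSe | hSn
  · rw [hSe, csSup_empty, Nat.bot_eq_zero, Nat.cast_zero]
    exact mul_pos (by linarith) (div_pos (by linarith) (by linarith))
  · have hbdd : BddAbove S := by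
      refine ⟨Nat.card (Projectivization F (Fin n → F)), ?_⟩
      rintro _ ⟨M, -, rfl⟩
      exact Set.ncard_le_card M
    obtain ⟨M, hM, hk⟩ := Nat.sSup_mem hSn hbdd
    rw [← hk]
    exact hmain M hM
end
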